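/- arXiv:2009.12365 — 8 statements merged into one kernel-verified Lean document; each statement's English description precedes it below -/
import Mathlib

section
/- Let D be a simple C*-algebra and let S be a set of *-automorphisms of D which is compact in the topology of pointwise norm convergence (that is, the set of underlying functions {α : D → D | α ∈ S} is a compact subset of D → D with the product topology, where D carries the norm topology). Then S is pseudoperiodic. -/
/-- `a` is Cuntz subequivalent to `b`: there is a sequence `(vₙ)` with `vₙ * b * vₙ* → a`. -/
def CuntzSubequiv {D : Type*} [NonUnitalCStarAlgebra D] (a b : D) : Prop :=
  ∃ v : ℕ → D, Filter.Tendsto (fun n => v n * b * star (v n)) Filter.atTop (nhds a)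

/-- A set `S` of ⋆-automorphisms of `D` is pseudoperiodic if for every nonzero positive `a`
there is a nonzero positive `b` such that `b ≾ α (a)` for every `α ∈ S ∪ {id}`. -/
def Pseudoperiodic {D : Type*} [NonUnitalCStarAlgebra D] [PartialOrder D] [StarOrderedRing D]
    (S : Set (D ≃⋆ₐ[ℂ] D)) : Prop :=
  ∀ a : D, 0 ≤ a → a ≠ 0 → ∃ b : D, 0 ≤ b ∧ b ≠ 0 ∧
    CuntzSubequiv b a ∧ ∀ α ∈ S, CuntzSubequiv b (α a)

/-- A C*-algebra is simple if its only closed two-sided ideals are `0` and the whole algebra. -/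
def IsSimpleCStarAlgebra (D : Type*) [NonUnitalCStarAlgebra D] : Prop :=
  ∀ I : TwoSidedIdeal D, IsClosed (I : Set D) → I = ⊥ ∨ I = ⊤

section
variable {D : Type*} [NonUnitalCStarAlgebra D]

theorem CuntzSubequiv.conj_left {a b : D} (h : CuntzSubequiv a b) (w : D) :
    CuntzSubequiv (w * a * star w) b := by
  obtain ⟨v, hv⟩ := h
  refine ⟨fun n => w * v n, ?_⟩
  have := (hv.const_mul w).mul_const (star w)
  simpa only [star_mul, mul_assoc] using this

theorem CuntzSubequiv.of_conj_right {a b : D} (w : D) (h : CuntzSubequiv a (w * b * star w)) :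
    CuntzSubequiv a b := by
  obtain ⟨v, hv⟩ := h
  exact ⟨fun n => v n * w, by simpa only [star_mul, mul_assoc] using hv⟩

/-- A simple C*-algebra is prime. -/
theorem IsSimpleCStarAlgebra.exists_mul_mul_ne_zero (hD : IsSimpleCStarAlgebra D) {x y : D}
    (hx : x ≠ 0) (hy : y ≠ 0) : ∃ z, x * z * y ≠ 0 := by
  by_contra! h
  let I : TwoSidedIdeal D := TwoSidedIdeal.mk' {w | ∀ z, x * z * w = 0}
    (by simp)
    (by intro u v hu hv z; simp [mul_add, hu z, hv z])
    (by intro u hu z; simp [hu z])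
    (by intro u v hv z; simpa [mul_assoc] using hv (z * u))
    (by intro u v hu z; rw [← mul_assoc, hu z, zero_mul])
  have hmem : ∀ w, w ∈ I ↔ ∀ z, x * z * w = 0 := fun w => by
    simp [I, TwoSidedIdeal.mem_mk']
  have hI : IsClosed (I : Set D) := by
    have : (I : Set D) = ⋂ z, {w | x * z * w = 0} := by
      ext w; simp [hmem]
    rw [this]
    exact isClosed_iInter fun z => isClosed_eq (by fun_prop) continuous_const
  rcases hD I hI with h0 | h1
  · have : y ∈ I := (hmem y).2 h
    rw [h0, TwoSidedIdeal.mem_bot] at this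
    exact hy this
  · have hxI : x ∈ I := by rw [h1]; trivial
    have h2 := (hmem x).1 hxI (star x)
    have h3 : x * star x = 0 := by
      rw [← CStarRing.mul_star_self_eq_zero_iff]
      rw [star_mul, star_star, ← mul_assoc, h2, zero_mul]
    exact hx ((CStarRing.mul_star_self_eq_zero_iff x).1 h3)

variable [PartialOrder D] [StarOrderedRing D]

/-- In a simple C*-algebra, two nonzero positive elements have a common nonzero lower bound
for Cuntz subequivalence, realised by exact conjugation. -/
theorem IsSimpleCStarAlgebra.exists_common_conj (hD : IsSimpleCStarAlgebra D) {x y : D}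
    (hx : 0 ≤ x) (hx0 : x ≠ 0) (hy : 0 ≤ y) (hy0 : y ≠ 0) :
    ∃ b : D, 0 ≤ b ∧ b ≠ 0 ∧ (∃ v, b = v * x * star v) ∧ ∃ w, b = w * y * star w := by
  obtain ⟨s, hs, hss⟩ : ∃ s : D, star s = s ∧ s * s = x :=
    ⟨CFC.sqrt x, (CFC.sqrt_nonneg x).isSelfAdjoint.star_eq, CFC.sqrt_mul_sqrt_self x⟩
  obtain ⟨t, ht, htt⟩ : ∃ t : D, star t = t ∧ t * t = y :=
    ⟨CFC.sqrt y, (CFC.sqrt_nonneg y).isSelfAdjoint.star_eq, CFC.sqrt_mul_sqrt_self y⟩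
  have hs0 : s ≠ 0 := by rintro rfl; simp at hss; exact hx0 hss.symm
  have ht0 : t ≠ 0 := by rintro rfl; simp at htt; exact hy0 htt.symm
  obtain ⟨z, hz⟩ := hD.exists_mul_mul_ne_zero hs0 ht0
  set r := s * z * t with hr
  refine ⟨(r * star r) * star (r * star r), mul_star_self_nonneg _, ?_,
    ⟨r * t * star z, ?_⟩, ⟨CFC.sqrt (r * star r) * (s * z), ?_⟩⟩
  · rw [Ne, CStarRing.mul_star_self_eq_zero_iff, CStarRing.mul_star_self_eq_zero_iff]
    exact hz
  · rw [← hss]; simp only [hr, star_mul, star_star, hs, ht, mul_assoc]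
  · set u := CFC.sqrt (r * star r)
    have hu : star u = u := (CFC.sqrt_nonneg _).isSelfAdjoint.star_eq
    have huu : u * u = r * star r := CFC.sqrt_mul_sqrt_self _ (mul_star_self_nonneg r)
    have hry : s * z * y * star (s * z) = u * u := by
      rw [huu, ← htt, hr, star_mul (s * z) t, ht]; simp only [mul_assoc]
    calc r * star r * star (r * star r) = u * (u * u) * u := by
          rw [← huu, star_mul, hu]; simp only [mul_assoc]
      _ = u * (s * z) * y * star (u * (s * z)) := by
          rw [← hry, star_mul u (s * z), hu]; simp only [mul_assoc]

theorem IsSimpleCStarAlgebra.exists_common_conj_finset (hD : IsSimpleCStarAlgebra D) {a : D}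
    (ha : 0 ≤ a) (ha0 : a ≠ 0) (t : Finset D) (ht : ∀ x ∈ t, 0 ≤ x ∧ x ≠ 0) :
    ∃ b : D, 0 ≤ b ∧ b ≠ 0 ∧ ∀ x ∈ t, ∃ v, b = v * x * star v := by
  classical
  induction t using Finset.induction_on with
  | empty => exact ⟨a, ha, ha0, by simp⟩
  | insert x t _ ih =>
    obtain ⟨b, hb, hb0, h⟩ := ih fun y hy => ht y (Finset.mem_insert_of_mem hy)
    obtain ⟨hx, hx0⟩ := ht x (Finset.mem_insert_self x t)
    obtain ⟨c, hc, hc0, ⟨v, hv⟩, w, hw⟩ := hD.exists_common_conj hx hx0 hb hb0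
    refine ⟨c, hc, hc0, fun y hy => ?_⟩
    rcases Finset.mem_insert.1 hy with rfl | hy
    · exact ⟨v, hv⟩
    · obtain ⟨u, hu⟩ := h y hy
      exact ⟨w * u, by rw [hw, hu]; simp only [star_mul, mul_assoc]⟩

/-- An approximate-unit estimate: if `0 ≤ p ≤ q` then `√p` is almost fixed by `q (q + δ)⁻¹`. -/
theorem norm_sqrt_sub_sqrt_mul_sq_le {p q : D} (hp : 0 ≤ p) (hpq : p ≤ q) {δ : ℝ} (hδ : 0 < δ) :
    ‖CFC.sqrt p - CFC.sqrt p * cfcₙ (fun t : ℝ => t / (|t| + δ)) q‖ ^ 2 ≤ δ := by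
  have hq : 0 ≤ q := hp.trans hpq
  have hqs : IsSelfAdjoint q := hq.isSelfAdjoint
  set f := cfcₙ (fun t : ℝ => t / (|t| + δ)) q
  have hcont : Continuous (fun t : ℝ => t / (|t| + δ)) :=
    continuous_id.div (by fun_prop) fun t => by positivity
  have hfs : star f = f := (cfcₙ_predicate (R := ℝ) _ q : IsSelfAdjoint f).star_eq
  set s := CFC.sqrt p
  have hs : star s = s := (CFC.sqrt_nonneg p).isSelfAdjoint.star_eq
  have hss : s * s = p := CFC.sqrt_mul_sqrt_self p
  set r := CFC.sqrt (q - p)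
  have hr : star r = r := (CFC.sqrt_nonneg (q - p)).isSelfAdjoint.star_eq
  have hrr : r * r = q - p := CFC.sqrt_mul_sqrt_self _ (sub_nonneg.2 hpq)
  have h1 : star (s - s * f) * (s - s * f) = p - f * p - p * f + f * p * f := by
    rw [← hss]; simp only [star_sub, star_mul, hs, hfs]; noncomm_ring
  have h2 : star (r - r * f) * (r - r * f) =
      (q - f * q - q * f + f * q * f) - (p - f * p - p * f + f * p * f) := by
    have : star (r - r * f) * (r - r * f) =
        r * r - f * (r * r) - (r * r) * f + f * (r * r) * f := by
      simp only [star_sub, star_mul, hr, hfs]; noncomm_ring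
    rw [this, hrr]; noncomm_ring
  have h3 : star (s - s * f) * (s - s * f) ≤ q - f * q - q * f + f * q * f := by
    rw [h1, ← sub_nonneg, ← h2]; exact star_mul_self_nonneg _
  have h4 : q - f * q - q * f + f * q * f = cfcₙ (fun t : ℝ => t - t / (|t| + δ) * t
      - t * (t / (|t| + δ)) + t / (|t| + δ) * t * (t / (|t| + δ))) q := by
    have e := cfcₙ_id' ℝ q
    have hc := hcont.continuousOn (s := quasispectrum ℝ q)
    have hi : ContinuousOn (fun t : ℝ => t) (quasispectrum ℝ q) := continuousOn_id
    rw [cfcₙ_add (fun t : ℝ => t - t / (|t| + δ) * t - t * (t / (|t| + δ)))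
        (fun t : ℝ => t / (|t| + δ) * t * (t / (|t| + δ))) q
        ((hi.sub (hc.mul hi)).sub (hi.mul hc)) (by simp) ((hc.mul hi).mul hc) (by simp),
      cfcₙ_sub (fun t : ℝ => t - t / (|t| + δ) * t) (fun t : ℝ => t * (t / (|t| + δ))) q
        (hi.sub (hc.mul hi)) (by simp) (hi.mul hc) (by simp),
      cfcₙ_sub (fun t : ℝ => t) (fun t : ℝ => t / (|t| + δ) * t) q
        hi (by simp) (hc.mul hi) (by simp),
      cfcₙ_mul (fun t : ℝ => t / (|t| + δ) * t) (fun t : ℝ => t / (|t| + δ)) q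
        (hc.mul hi) (by simp) hc (by simp),
      cfcₙ_mul (fun t : ℝ => t / (|t| + δ)) (fun t : ℝ => t) q hc (by simp) hi (by simp),
      cfcₙ_mul (fun t : ℝ => t) (fun t : ℝ => t / (|t| + δ)) q hi (by simp) hc (by simp), e]
  rw [sq, ← CStarRing.norm_star_mul_self]
  refine (CStarAlgebra.norm_le_norm_of_nonneg_of_le (star_mul_self_nonneg _) h3).trans ?_
  rw [h4]
  refine norm_cfcₙ_le fun t ht => ?_
  have ht0 : 0 ≤ t := quasispectrum_nonneg_of_nonneg q hq t ht
  rw [abs_of_nonneg ht0]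
  have hpos : 0 < t + δ := by positivity
  have : t - t / (t + δ) * t - t * (t / (t + δ)) + t / (t + δ) * t * (t / (t + δ))
      = t * δ ^ 2 / (t + δ) ^ 2 := by
    field_simp; ring
  rw [this, Real.norm_of_nonneg (by positivity), div_le_iff₀ (by positivity)]
  nlinarith [mul_nonneg ht0 hδ.le, mul_nonneg (mul_nonneg ht0 ht0) hδ.le,
    mul_nonneg (mul_nonneg ht0 hδ.le) hδ.le, pow_pos hδ 3]

theorem CuntzSubequiv.of_le {p q : D} (hp : 0 ≤ p) (hpq : p ≤ q) : CuntzSubequiv p q := by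
  have hq : 0 ≤ q := hp.trans hpq
  have hqs : IsSelfAdjoint q := hq.isSelfAdjoint
  set s := CFC.sqrt p
  have hs : star s = s := (CFC.sqrt_nonneg p).isSelfAdjoint.star_eq
  have hss : s * s = p := CFC.sqrt_mul_sqrt_self p
  let δ : ℕ → ℝ := fun n => 1 / ((n : ℝ) + 1)
  have hδ : ∀ n, 0 < δ n := fun n => by positivity
  let f : ℕ → D := fun n => cfcₙ (fun t : ℝ => t / (|t| + δ n)) q
  let g : ℕ → D := fun n => cfcₙ (fun t : ℝ => √|t| / (|t| + δ n)) q
  have hfs : ∀ n, star (f n) = f n :=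
    fun n => (cfcₙ_predicate (R := ℝ) _ q : IsSelfAdjoint (f n)).star_eq
  have hgs : ∀ n, star (g n) = g n :=
    fun n => (cfcₙ_predicate (R := ℝ) _ q : IsSelfAdjoint (g n)).star_eq
  have hgf : ∀ n, g n * q * g n = f n * f n := by
    intro n
    have hpos : ∀ t : ℝ, |t| + δ n ≠ 0 := fun t => by have := hδ n; positivity
    have hcf : ContinuousOn (fun t : ℝ => t / (|t| + δ n)) (quasispectrum ℝ q) :=
      (continuous_id.div (by fun_prop) hpos).continuousOn
    have hcg : ContinuousOn (fun t : ℝ => √|t| / (|t| + δ n)) (quasispectrum ℝ q) :=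
      (Continuous.div (by fun_prop) (by fun_prop) hpos).continuousOn
    have hi : ContinuousOn (fun t : ℝ => t) (quasispectrum ℝ q) := continuousOn_id
    have e := cfcₙ_id' ℝ q
    calc g n * q * g n
        = cfcₙ (fun t : ℝ => √|t| / (|t| + δ n) * t * (√|t| / (|t| + δ n))) q := by
          rw [cfcₙ_mul (fun t : ℝ => √|t| / (|t| + δ n) * t) (fun t : ℝ => √|t| / (|t| + δ n)) q
            (hcg.mul hi) (by simp) hcg (by simp),
            cfcₙ_mul (fun t : ℝ => √|t| / (|t| + δ n)) (fun t : ℝ => t) q hcg (by simp) hi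
            (by simp), e]
      _ = cfcₙ (fun t : ℝ => t / (|t| + δ n) * (t / (|t| + δ n))) q := by
          refine cfcₙ_congr fun t ht => ?_
          have ht0 : 0 ≤ t := quasispectrum_nonneg_of_nonneg q hq t ht
          have hsq := Real.mul_self_sqrt ht0
          simp only [abs_of_nonneg ht0]
          calc √t / (t + δ n) * t * (√t / (t + δ n))
              = (√t * √t) * t * ((t + δ n)⁻¹ * (t + δ n)⁻¹) := by ring
            _ = t / (t + δ n) * (t / (t + δ n)) := by rw [hsq]; ring
      _ = f n * f n := cfcₙ_mul _ _ q hcf (by simp) hcf (by simp)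
  have hlim : Filter.Tendsto (fun n => s * f n) Filter.atTop (nhds s) := by
    rw [tendsto_iff_norm_sub_tendsto_zero]
    have hsq : Filter.Tendsto (fun n => ‖s * f n - s‖ ^ 2) Filter.atTop (nhds 0) :=
      squeeze_zero (fun n => by positivity)
        (fun n => by
          rw [norm_sub_rev]
          exact norm_sqrt_sub_sqrt_mul_sq_le hp hpq (hδ n))
        tendsto_one_div_add_atTop_nhds_zero_nat
    have := (Real.continuous_sqrt.tendsto 0).comp hsq
    simpa [Function.comp_def, Real.sqrt_sq (norm_nonneg _)] using this
  refine ⟨fun n => s * g n, ?_⟩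
  have h := hlim.mul ((continuous_star.tendsto s).comp hlim)
  rw [hs, hss] at h
  refine h.congr fun n => ?_
  simp only [Function.comp_apply, star_mul, hs, hfs, hgs]
  calc s * f n * (f n * s) = s * (f n * f n) * s := by noncomm_ring
    _ = s * g n * q * (g n * s) := by rw [← hgf]; noncomm_ring

/-- The cut-down `(c - ε)₊ ^ 3` of a positive element `c` of norm larger than `ε` is a nonzero
positive element which is Cuntz subequivalent to everything within distance `ε` of `c`. -/
theorem exists_cuntzSubequiv_of_dist_le {c : D} (hc : 0 ≤ c) {ε : ℝ} (hε : 0 ≤ ε)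
    (hεc : ε < ‖c‖) :
    ∃ x : D, 0 ≤ x ∧ x ≠ 0 ∧ ∀ d : D, 0 ≤ d → ‖c - d‖ ≤ ε → CuntzSubequiv x d := by
  have hcs : IsSelfAdjoint c := hc.isSelfAdjoint
  have hk0 : max ((0 : ℝ) - ε) 0 = 0 := by simp [hε]
  set k : D := cfcₙ (fun t : ℝ => max (t - ε) 0) c
  have hk : star k = k := (cfcₙ_predicate (R := ℝ) _ c : IsSelfAdjoint k).star_eq
  have hck : ContinuousOn (fun t : ℝ => max (t - ε) 0) (quasispectrum ℝ c) := by fun_prop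
  have hi : ContinuousOn (fun t : ℝ => t) (quasispectrum ℝ c) := continuousOn_id
  have e := cfcₙ_id' ℝ c
  have hx : k * c * k - ε • (k * k) = cfcₙ (fun t : ℝ => max (t - ε) 0 * max (t - ε) 0
      * max (t - ε) 0) c := by
    calc k * c * k - ε • (k * k)
        = cfcₙ (fun t : ℝ => max (t - ε) 0 * t * max (t - ε) 0
            - ε • (max (t - ε) 0 * max (t - ε) 0)) c := by
          rw [cfcₙ_sub (fun t : ℝ => max (t - ε) 0 * t * max (t - ε) 0)
              (fun t : ℝ => ε • (max (t - ε) 0 * max (t - ε) 0)) c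
              ((hck.mul hi).mul hck) (by simp) ((hck.mul hck).const_smul ε) (by simp [hε]),
            cfcₙ_smul ε (fun t : ℝ => max (t - ε) 0 * max (t - ε) 0) c (hck.mul hck)
              (by simp [hε]),
            cfcₙ_mul (fun t : ℝ => max (t - ε) 0 * t) (fun t : ℝ => max (t - ε) 0) c
              (hck.mul hi) (by simp) hck hk0,
            cfcₙ_mul (fun t : ℝ => max (t - ε) 0) (fun t : ℝ => t) c hck hk0 hi (by simp),
            cfcₙ_mul (fun t : ℝ => max (t - ε) 0) (fun t : ℝ => max (t - ε) 0) c
              hck hk0 hck hk0, e]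
      _ = _ := by
          refine cfcₙ_congr fun t _ => ?_
          rcases le_total t ε with h | h
          · simp [max_eq_right (sub_nonpos.2 h)]
          · simp only [max_eq_left (sub_nonneg.2 h), smul_eq_mul]; ring
  have hx0 : 0 ≤ k * c * k - ε • (k * k) := by
    rw [hx]
    refine cfcₙ_nonneg fun t _ => ?_
    positivity
  refine ⟨k * c * k - ε • (k * k), hx0, fun h => ?_, fun d hd hcd => ?_⟩
  · rw [hx] at h
    have hle : ‖cfcₙ (fun t : ℝ => t) c‖ ≤ ε := by
      refine norm_cfcₙ_le fun t ht => ?_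
      have ht0 : 0 ≤ t := quasispectrum_nonneg_of_nonneg c hc t ht
      have hn := norm_apply_le_norm_cfcₙ (𝕜 := ℝ) (fun t : ℝ => max (t - ε) 0 * max (t - ε) 0
        * max (t - ε) 0) c ht ((hck.mul hck).mul hck) (by simp [hε]) hcs
      rw [h, norm_zero, norm_le_zero_iff] at hn
      rw [Real.norm_of_nonneg ht0]
      by_contra! hlt
      have : 0 < max (t - ε) 0 := lt_max_of_lt_left (sub_pos.2 hlt)
      have : 0 < max (t - ε) 0 * max (t - ε) 0 * max (t - ε) 0 := by positivity
      exact this.ne' hn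
    rw [e] at hle
    exact hle.not_gt hεc
  · have h1 : star k * (c - d) * k ≤ ‖c - d‖ • (star k * k) :=
      CStarAlgebra.star_left_conjugate_le_norm_smul (hcs.sub hd.isSelfAdjoint)
    have h2 : ‖c - d‖ • (star k * k) ≤ ε • (star k * k) :=
      smul_le_smul_of_nonneg_right hcd (star_mul_self_nonneg k)
    have h3 := h1.trans h2
    rw [hk] at h3
    have h4 : k * c * k - ε • (k * k) ≤ k * d * star k := by
      rw [hk]
      rw [mul_sub, sub_mul] at h3
      exact sub_le_comm.1 h3
    exact (CuntzSubequiv.of_le hx0 h4).of_conj_right k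

/-- A compact set of positive elements of a simple C*-algebra, bounded away from zero, has a
common nonzero lower bound for Cuntz subequivalence. -/
theorem IsSimpleCStarAlgebra.exists_cuntzSubequiv_of_isCompact (hD : IsSimpleCStarAlgebra D)
    {K : Set D} (hK : IsCompact K) (hne : K.Nonempty) {ε : ℝ} (hε : 0 < ε)
    (hpos : ∀ c ∈ K, 0 ≤ c) (hnorm : ∀ c ∈ K, ε < ‖c‖) :
    ∃ b : D, 0 ≤ b ∧ b ≠ 0 ∧ ∀ d ∈ K, CuntzSubequiv b d := by
  classical
  obtain ⟨a, ha⟩ := hne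
  choose! x hx hx0 hxd using fun c (hc : c ∈ K) =>
    exists_cuntzSubequiv_of_dist_le (hpos c hc) hε.le (hnorm c hc)
  obtain ⟨t, htK, htf, hcov⟩ := hK.finite_cover_balls hε
  obtain ⟨b, hb, hb0, h⟩ := hD.exists_common_conj_finset (hpos a ha)
    (norm_pos_iff.1 (hε.trans (hnorm a ha))) (htf.toFinset.image x) (by
      intro y hy
      obtain ⟨c, hc, rfl⟩ := Finset.mem_image.1 hy
      have hcK := htK (htf.mem_toFinset.1 hc)
      exact ⟨hx c hcK, hx0 c hcK⟩)
  refine ⟨b, hb, hb0, fun d hd => ?_⟩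
  obtain ⟨c, hc, hdc⟩ := Set.mem_iUnion₂.1 (hcov hd)
  obtain ⟨v, hv⟩ := h (x c) (Finset.mem_image_of_mem x (htf.mem_toFinset.2 hc))
  rw [hv]
  refine (hxd c (htK hc) d (hpos d hd) ?_).conj_left v
  rw [← dist_eq_norm, dist_comm]
  exact (Metric.mem_ball.1 hdc).le

end

/-- Let `D` be a simple C*-algebra and `S` a set of ⋆-automorphisms of `D`
which is compact in the topology of pointwise norm convergence (i.e., the corresponding set of
functions `D → D` is compact for the product topology).  Then `S` is pseudoperiodic. -/
theorem pseudoperiodic_of_isCompact {D : Type*} [NonUnitalCStarAlgebra D] [PartialOrder D]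
    [StarOrderedRing D] (hD : IsSimpleCStarAlgebra D) (S : Set (D ≃⋆ₐ[ℂ] D))
    (hS : IsCompact ((fun α : D ≃⋆ₐ[ℂ] D => (⇑α : D → D)) '' S)) :
    Pseudoperiodic S := by
  intro a ha ha0
  have hcompact : IsCompact (insert a ((fun α : D ≃⋆ₐ[ℂ] D => α a) '' S)) := by
    have h := (hS.image (continuous_apply a)).insert a
    rwa [Set.image_image] at h
  have hn : 0 < ‖a‖ := norm_pos_iff.2 ha0
  obtain ⟨b, hb, hb0, h⟩ := hD.exists_cuntzSubequiv_of_isCompact hcompact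
    (Set.insert_nonempty _ _) (half_pos hn)
    (by
      rintro c (rfl | ⟨α, -, rfl⟩)
      · exact ha
      · exact map_nonneg α ha)
    (by
      rintro c (rfl | ⟨α, -, rfl⟩)
      · exact half_lt_self hn
      · have : ‖α a‖ = ‖a‖ := NonUnitalStarAlgHom.norm_map α (EquivLike.injective α) a
        simp only [this]
        exact half_lt_self hn)
  exact ⟨b, hb, hb0, h a (Set.mem_insert _ _), fun α hα =>
    h (α a) (Set.mem_insert_of_mem _ ⟨α, hα, rfl⟩)⟩
end

section
/- Let A, B, and C be C*-algebras, and let φ : A → C and ψ : B → C be *-homomorphisms with ψ surjective. If A and B have stable rank one, then the pullback C*-algebra D = {(a, b) ∈ A ⊕ B : φ(a) = ψ(b)} has stable rank one. -/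
/-- A C*-algebra has stable rank one if the invertible elements of its minimal unitization are
dense in the minimal unitization. -/
def StableRankOne (A : Type*) [NonUnitalCStarAlgebra A] : Prop :=
  Dense {x : Unitization ℂ A | IsUnit x}

open scoped Topology CStarAlgebra in
/-- If `ψ : B → C` is a surjective unital ⋆-homomorphism and the invertibles are dense in `B`, then
any `b` with `ψ b` invertible is a limit of invertibles with the same image in `C`. -/
theorem exists_isUnit_map_eq_dist_lt {B C : Type*} [CStarAlgebra B] [CStarAlgebra C]
    (ψ : B →⋆ₐ[ℂ] C) (hψ : Function.Surjective ψ) (hB : Dense {x : B | IsUnit x})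
    {b : B} (hb : IsUnit (ψ b)) {ε : ℝ} (hε : 0 < ε) :
    ∃ y : B, IsUnit y ∧ ψ y = ψ b ∧ dist y b < ε := by
  have hψc : Continuous ψ := map_continuous ψ
  have hopen : IsOpenMap ψ :=
    ContinuousLinearMap.isOpenMap (⟨ψ.toAlgHom.toLinearMap, hψc⟩ : B →L[ℂ] C) hψ
  obtain ⟨c, hc⟩ := hb
  have hcont : ContinuousAt (fun p : B × B ↦ p.1 * Ring.inverse p.2) (b, 1) := by
    refine continuousAt_fst.mul (ContinuousAt.comp (g := Ring.inverse) ?_ continuousAt_snd)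
    simpa using NormedRing.inverse_continuousAt (1 : Bˣ)
  have hball : ∀ᶠ p in 𝓝 b ×ˢ 𝓝 (1 : B), dist (p.1 * Ring.inverse p.2) b < ε := by
    rw [← nhds_prod_eq]
    have := hcont.tendsto
    simp only [Ring.inverse_one, mul_one] at this
    exact this.eventually (Metric.ball_mem_nhds b hε)
  obtain ⟨S, hS, T, hT, hST⟩ := Filter.mem_prod_iff.1 hball
  have hT' : T ∩ {t : B | IsUnit t} ∈ 𝓝 (1 : B) :=
    Filter.inter_mem hT (Units.isOpen.mem_nhds isUnit_one)
  have himage : ψ '' (T ∩ {t : B | IsUnit t}) ∈ 𝓝 (1 : C) := by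
    simpa using hopen.image_mem_nhds hT'
  have hpre : ∀ᶠ x in 𝓝 b, ↑c⁻¹ * ψ x ∈ ψ '' (T ∩ {t : B | IsUnit t}) := by
    have h : ContinuousAt (fun x ↦ ↑c⁻¹ * ψ x) b := by fun_prop
    refine h.eventually_mem ?_
    simpa only [← hc, Units.inv_mul] using himage
  obtain ⟨⟨x, hx⟩, hxS, _, ⟨htT, u, rfl⟩, hxt⟩ :=
    mem_closure_iff_nhds'.1 (hB b) _ (Filter.inter_mem hS hpre)
  refine ⟨x * ↑u⁻¹, hx.mul u⁻¹.isUnit, ?_, ?_⟩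
  · have hx' : ψ x = c * ψ u := by simp [hxt]
    rw [map_mul, hx', mul_assoc, ← map_mul, Units.mul_inv, map_one, mul_one, hc]
  · simpa using hST (Set.mk_mem_prod hxS htT)

open scoped Topology CStarAlgebra in
/-- Unital version of `pullback_stableRankOne`: if `P` is the pullback of `φ : A → C` along a
surjection `ψ : B → C`, and the invertibles are dense in `A` and `B`, they are dense in `P`. -/
theorem dense_isUnit_pullback {A B C P : Type*} [CStarAlgebra A] [CStarAlgebra B]
    [CStarAlgebra C] [CStarAlgebra P] (φ : A →⋆ₐ[ℂ] C) (ψ : B →⋆ₐ[ℂ] C)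
    (hψ : Function.Surjective ψ) (e : P →⋆ₐ[ℂ] A × B) (he : Function.Injective e)
    (hrange : Set.range e = {p : A × B | φ p.1 = ψ p.2})
    (hA : Dense {x : A | IsUnit x}) (hB : Dense {x : B | IsUnit x}) :
    Dense {x : P | IsUnit x} := by
  have hiso : Isometry e := NonUnitalStarAlgHom.isometry e he
  have hψc : Continuous ψ := map_continuous ψ
  have hφc : Continuous φ := map_continuous φ
  have hopen : IsOpenMap ψ :=
    ContinuousLinearMap.isOpenMap (⟨ψ.toAlgHom.toLinearMap, hψc⟩ : B →L[ℂ] C) hψ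
  have hunit : ∀ p, IsUnit (e p) → IsUnit p := by
    rintro p ⟨u, hu⟩
    have hp : φ (u : A × B).1 = ψ (u : A × B).2 := by
      have : e p ∈ Set.range e := ⟨p, rfl⟩
      rwa [hrange, ← hu] at this
    have hinv : (↑u⁻¹ : A × B) ∈ Set.range e := by
      rw [hrange]
      let f : A × B →* C := φ.toAlgHom.toMonoidHom.comp (MonoidHom.fst A B)
      let g : A × B →* C := ψ.toAlgHom.toMonoidHom.comp (MonoidHom.snd A B)
      have : Units.map f u = Units.map g u := Units.ext hp
      exact congrArg (fun v : Cˣ ↦ (↑v⁻¹ : C)) this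
    obtain ⟨q, hq⟩ := hinv
    refine ⟨⟨p, q, he ?_, he ?_⟩, rfl⟩
    · rw [map_mul, map_one, hq, ← hu, Units.mul_inv]
    · rw [map_mul, map_one, hq, ← hu, Units.inv_mul]
  refine Metric.dense_iff.2 fun p ε hε ↦ ?_
  have hp : φ (e p).1 = ψ (e p).2 := by
    have : e p ∈ Set.range e := ⟨p, rfl⟩
    rwa [hrange] at this
  have himage : ψ '' Metric.ball (e p).2 (ε / 2) ∈ 𝓝 (φ (e p).1) :=
    hp ▸ hopen.image_mem_nhds (Metric.ball_mem_nhds _ (half_pos hε))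
  obtain ⟨⟨a, ha⟩, haε, b, hb, hab⟩ := mem_closure_iff_nhds'.1 (hA (e p).1) _
    (Filter.inter_mem (Metric.ball_mem_nhds _ hε) (hφc.continuousAt himage))
  obtain ⟨y, hy, hyb, hyε⟩ := exists_isUnit_map_eq_dist_lt ψ hψ hB (b := b)
    (hab ▸ ha.map φ) (half_pos hε)
  obtain ⟨q, hq⟩ : (a, y) ∈ Set.range e := by
    rw [hrange]
    exact (hyb.trans hab).symm
  refine ⟨q, ?_, hunit q (hq ▸ Prod.isUnit_iff.2 ⟨ha, hy⟩)⟩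
  rw [Metric.mem_ball, ← hiso.dist_eq, hq, Prod.dist_eq]
  refine max_lt haε ?_
  calc dist y (e p).2 ≤ dist y b + dist b (e p).2 := dist_triangle _ _ _
    _ < ε / 2 + ε / 2 := add_lt_add hyε hb
    _ = ε := add_halves ε

/-- Let `A`, `B`, `C` be C*-algebras, `φ : A → C` and `ψ : B → C`
⋆-homomorphisms with `ψ` surjective.  If `A` and `B` have stable rank one, then the pullback
C*-algebra `{(a, b) ∈ A ⊕ B : φ a = ψ b}` (here realized as any C*-algebra `P` that is
⋆-isomorphic to it, via an injective ⋆-homomorphism `e : P → A × B` whose range is the pullback)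
has stable rank one. -/
theorem pullback_stableRankOne {A B C P : Type*} [NonUnitalCStarAlgebra A]
    [NonUnitalCStarAlgebra B] [NonUnitalCStarAlgebra C] [NonUnitalCStarAlgebra P]
    (φ : A →⋆ₙₐ[ℂ] C) (ψ : B →⋆ₙₐ[ℂ] C) (hψ : Function.Surjective ψ)
    (e : P →⋆ₙₐ[ℂ] A × B) (he : Function.Injective e)
    (hrange : Set.range e = {p : A × B | φ p.1 = ψ p.2})
    (hA : StableRankOne A) (hB : StableRankOne B) :
    StableRankOne P := by
  let f : P →⋆ₙₐ[ℂ] A := (NonUnitalStarAlgHom.fst ℂ A B).comp e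
  let g : P →⋆ₙₐ[ℂ] B := (NonUnitalStarAlgHom.snd ℂ A B).comp e
  refine dense_isUnit_pullback (Unitization.starMap φ) (Unitization.starMap ψ)
    (Unitization.starMap_surjective hψ)
    ((Unitization.starMap f).prod (Unitization.starMap g)) ?_ ?_ hA hB
  · intro x y hxy
    induction x with | inl_add_inr r x
    induction y with | inl_add_inr s y
    simp [f, g, Unitization.ext_iff, Unitization.algebraMap_eq_inl] at hxy
    obtain ⟨⟨rfl, h₁⟩, -, h₂⟩ := hxy
    rw [he (Prod.ext h₁ h₂)]
  · ext ⟨x, y⟩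
    induction x with | inl_add_inr r a
    induction y with | inl_add_inr s b
    have hab : (∃ p, e p = (a, b)) ↔ φ a = ψ b := Set.ext_iff.1 hrange (a, b)
    simp [f, g, Unitization.ext_iff, Unitization.algebraMap_eq_inl]
    rw [← hab]
    constructor
    · rintro ⟨p, ⟨rfl, h₁⟩, rfl, h₂⟩
      exact ⟨rfl, p.snd, Prod.ext h₁ h₂⟩
    · rintro ⟨rfl, p, hp⟩
      exact ⟨Unitization.inl r + (p : Unitization ℂ P), by simp [hp]⟩
end

section
/- Let I be a set and let (θ_i)_{i ∈ I} be a family of real numbers such that the real numbers 1 and θ_i for i ∈ I are linearly independent over ℚ. Then the translation r : (ℝ/ℤ)^I → (ℝ/ℤ)^I given coordinatewise by r(x)_i = x_i + θ_i (mod 1) is a minimal homeomorphism, i.e., every orbit {rⁿ(x) : n ∈ ℤ} is dense in (ℝ/ℤ)^I. -/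
open MeasureTheory

namespace UnitAddTorus

variable {d : Type*} [Fintype d]

lemma mFourier_apply_add (n : d → ℤ) (x y : UnitAddTorus d) :
    mFourier n (x + y) = mFourier n x * mFourier n y := by
  simp [mFourier, AddCircle.toCircle_add, Finset.prod_mul_distrib]

lemma mFourier_apply_coe (n : d → ℤ) (θ : d → ℝ) :
    mFourier n (fun i => (θ i : UnitAddCircle)) =
      AddCircle.toCircle ((∑ i, n i * θ i : ℝ) : UnitAddCircle) := by
  have h : ∀ s : Finset d, ∏ i ∈ s, fourier (n i) (θ i : UnitAddCircle) =
      (AddCircle.toCircle ((∑ i ∈ s, n i * θ i : ℝ) : UnitAddCircle) : ℂ) := by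
    classical
    intro s
    induction s using Finset.induction_on with
    | empty => simp
    | insert i s hi ih =>
      rw [Finset.prod_insert hi, Finset.sum_insert hi, ih, AddCircle.coe_add,
        AddCircle.toCircle_add, Circle.coe_mul, fourier_apply, ← AddCircle.coe_zsmul,
        zsmul_eq_mul]
  exact h Finset.univ

/-- Finite measures on a torus are determined by their Fourier coefficients. -/
theorem measure_ext_of_integral_mFourier {μ ν : Measure (UnitAddTorus d)} [IsFiniteMeasure μ]
    [IsFiniteMeasure ν] (h : ∀ n, ∫ x, mFourier n x ∂μ = ∫ x, mFourier n x ∂ν) : μ = ν := by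
  have int_of : ∀ (ρ : Measure (UnitAddTorus d)) [IsFiniteMeasure ρ] (f : C(UnitAddTorus d, ℂ)),
      Integrable f ρ := fun ρ _ f =>
    (BoundedContinuousFunction.mkOfCompact f).integrable ρ
  have hcont : ∀ (ρ : Measure (UnitAddTorus d)) [IsFiniteMeasure ρ],
      Continuous fun f : C(UnitAddTorus d, ℂ) => ∫ x, f x ∂ρ := by
    intro ρ _
    have : (fun f : C(UnitAddTorus d, ℂ) => ∫ x, f x ∂ρ) =
        fun f => ∫ x, ContinuousMap.toLp (E := ℂ) 1 ρ ℂ f x ∂ρ := by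
      funext f
      exact integral_congr_ae (ContinuousMap.coeFn_toLp ρ f).symm
    rw [this]
    exact continuous_integral.comp (ContinuousMap.toLp (E := ℂ) 1 ρ ℂ).continuous
  have key : ∀ f : C(UnitAddTorus d, ℂ), ∫ x, f x ∂μ = ∫ x, f x ∂ν := by
    intro f
    have hf : f ∈ (Submodule.span ℂ (Set.range (mFourier (d := d)))).topologicalClosure := by
      rw [span_mFourier_closure_eq_top]; trivial
    rw [← SetLike.mem_coe, Submodule.topologicalClosure_coe] at hf
    refine closure_minimal (t := {f | ∫ x, f x ∂μ = ∫ x, f x ∂ν}) (fun g hg => ?_)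
      (isClosed_eq (hcont μ) (hcont ν)) hf
    induction hg using Submodule.span_induction with
    | mem g hg => obtain ⟨n, rfl⟩ := hg; exact h n
    | zero => simp
    | add g₁ g₂ _ _ h₁ h₂ =>
      simp only [Set.mem_ofPred_eq, ContinuousMap.add_apply] at *
      rw [integral_add (int_of μ g₁) (int_of μ g₂), integral_add (int_of ν g₁) (int_of ν g₂),
        h₁, h₂]
    | smul c g _ hg =>
      simp only [Set.mem_ofPred_eq, ContinuousMap.smul_apply, integral_smul] at *
      rw [hg]
  refine ext_of_forall_integral_eq_of_IsFiniteMeasure fun f => ?_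
  have := key ⟨fun x => (f x : ℂ), by fun_prop⟩
  simp only [ContinuousMap.coe_mk, integral_complex_ofReal] at this
  exact_mod_cast this

/-- A translation of a torus on which no nontrivial character is trivial is uniquely ergodic. -/
theorem measure_eq_of_measurePreserving_add {t : UnitAddTorus d}
    (ht : ∀ n, mFourier n t = 1 → n = 0) {μ ν : Measure (UnitAddTorus d)}
    [IsProbabilityMeasure μ] [IsProbabilityMeasure ν] (hμ : MeasurePreserving (· + t) μ μ)
    (hν : MeasurePreserving (· + t) ν ν) : μ = ν := by
  have key : ∀ (ρ : Measure (UnitAddTorus d)), MeasurePreserving (· + t) ρ ρ → ∀ n, n ≠ 0 →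
      ∫ x, mFourier n x ∂ρ = 0 := by
    intro ρ hρ n hn
    have h : ∫ x, mFourier n (x + t) ∂ρ = ∫ x, mFourier n x ∂ρ :=
      hρ.integral_comp (MeasurableEquiv.addRight t).measurableEmbedding _
    simp only [mFourier_apply_add, integral_mul_const] at h
    by_contra h₀
    exact hn (ht n (mul_left_cancel₀ h₀ (by rw [h, mul_one])))
  refine measure_ext_of_integral_mFourier fun n => ?_
  rcases eq_or_ne n 0 with rfl | hn
  · simp [mFourier_zero]
  · rw [key μ hμ n hn, key ν hν n hn]

/-- Kronecker's theorem: an element of a torus on which no nontrivial character is trivial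
generates a dense subgroup. -/
theorem dense_zmultiples {t : UnitAddTorus d} (ht : ∀ n, mFourier n t = 1 → n = 0) :
    Dense (AddSubgroup.zmultiples t : Set (UnitAddTorus d)) := by
  let H := (AddSubgroup.zmultiples t).topologicalClosure
  have hH : IsClosed (H : Set (UnitAddTorus d)) := AddSubgroup.isClosed_topologicalClosure _
  have : CompactSpace H := isCompact_iff_compactSpace.mp hH.isCompact
  let tH : H := ⟨t, AddSubgroup.le_topologicalClosure _ (AddSubgroup.mem_zmultiples t)⟩
  let μ : Measure H := Measure.addHaarMeasure ⊤
  have : IsProbabilityMeasure μ := ⟨by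
    simpa using Measure.addHaarMeasure_self (K₀ := (⊤ : TopologicalSpace.PositiveCompacts H))⟩
  have hm : Measurable (Subtype.val : H → UnitAddTorus d) := measurable_subtype_coe
  have : IsProbabilityMeasure (μ.map Subtype.val) :=
    Measure.isProbabilityMeasure_map hm.aemeasurable
  have hpres : MeasurePreserving (· + t) (μ.map Subtype.val) (μ.map Subtype.val) := by
    refine ⟨measurable_add_const t, ?_⟩
    rw [Measure.map_map (measurable_add_const t) hm]
    conv_rhs => rw [← map_add_right_eq_self μ tH, Measure.map_map hm (measurable_add_const tH)]
    rfl
  have : IsProbabilityMeasure (volume : Measure UnitAddCircle) := ⟨UnitAddCircle.measure_univ⟩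
  have heq : μ.map Subtype.val = (volume : Measure (UnitAddTorus d)) :=
    measure_eq_of_measurePreserving_add ht hpres (measurePreserving_add_right volume t)
  have hzero : (volume : Measure (UnitAddTorus d)) (H : Set (UnitAddTorus d))ᶜ = 0 := by
    rw [← heq, Measure.map_apply hm hH.measurableSet.compl]
    convert measure_empty (μ := μ)
    exact Set.eq_empty_of_forall_notMem fun h hh => hh h.2
  have hempty := (hH.isOpen_compl.measure_eq_zero_iff volume).mp hzero
  rw [Set.compl_empty_iff] at hempty
  rw [dense_iff_closure_eq, ← AddSubgroup.topologicalClosure_coe]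
  exact hempty

end UnitAddTorus

/-- Let `(θ i)_{i ∈ I}` be real numbers such that `1` together with the `θ i`
is linearly independent over `ℚ`.  Then the coordinatewise translation
`r x = (x i + θ i)_{i ∈ I}` of `(ℝ/ℤ)^I` is a minimal homeomorphism: every orbit
`{rⁿ x : n ∈ ℤ}` is dense. -/
theorem prod_rotation_minimal {I : Type*} (θ : I → ℝ)
    (hind : LinearIndependent ℚ (fun o : Option I => o.elim 1 θ)) :
    ∃ r : (I → AddCircle (1 : ℝ)) ≃ₜ (I → AddCircle (1 : ℝ)),
      (∀ (x : I → AddCircle (1 : ℝ)) (i : I), r x i = x i + ((θ i : ℝ) : AddCircle (1 : ℝ))) ∧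
      ∀ x : I → AddCircle (1 : ℝ),
        Dense (Set.range fun n : ℤ => (r.toEquiv ^ n) x) := by
  refine ⟨Homeomorph.addRight fun i => (θ i : AddCircle (1 : ℝ)), fun x i => rfl, fun x => ?_⟩
  have horbit : ∀ n : ℤ, ((Homeomorph.addRight fun i => (θ i : AddCircle (1 : ℝ))).toEquiv ^ n) x =
      x + n • fun i => (θ i : AddCircle (1 : ℝ)) := by
    intro n
    induction n using Int.induction_on generalizing x with
    | zero => simp
    | succ n ih =>
      rw [zpow_add_one, Equiv.Perm.mul_apply, ih, add_comm (n : ℤ), add_zsmul, one_zsmul,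
        ← add_assoc]
      rfl
    | pred n ih =>
      rw [zpow_sub_one, Equiv.Perm.mul_apply, ih, sub_eq_neg_add, add_zsmul, neg_one_zsmul,
        ← add_assoc]
      rfl
  simp only [horbit]
  rw [dense_iff_inter_open]
  rintro U hU ⟨a, ha⟩
  obtain ⟨J, u, hu, hsub⟩ := isOpen_pi_iff.mp hU a ha
  have hchar : ∀ n : J → ℤ,
      UnitAddTorus.mFourier n (fun j : J => (θ j : UnitAddCircle)) = 1 → n = 0 := by
    intro n hn
    rw [UnitAddTorus.mFourier_apply_coe, Circle.coe_eq_one, ← AddCircle.toCircle_zero (T := 1),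
      (AddCircle.injective_toCircle one_ne_zero).eq_iff, AddCircle.coe_eq_zero_iff] at hn
    obtain ⟨m, hm⟩ := hn
    have hinj : Function.Injective fun o : Option J => o.map (Subtype.val : J → I) :=
      Option.map_injective Subtype.val_injective
    have hli := Fintype.linearIndependent_iff.mp (hind.comp _ hinj)
      (fun o => o.elim (-m : ℚ) fun j => n j) (by
        simp only [zsmul_eq_mul, mul_one] at hm
        simp [Fintype.sum_option, Rat.smul_def, hm])
    funext j
    simpa using hli (some j)
  have hopen : IsOpen (Set.univ.pi fun j : J => (fun y => x j + y) ⁻¹' u j) :=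
    isOpen_set_pi Set.finite_univ fun j _ => (hu j j.2).1.preimage (by fun_prop)
  obtain ⟨_, hy, n, rfl⟩ := (UnitAddTorus.dense_zmultiples hchar).inter_open_nonempty _ hopen
    ⟨fun j => a j - x j, fun j _ => by simpa using (hu j j.2).2⟩
  exact ⟨_, hsub fun i hi => hy ⟨i, hi⟩ trivial, n, rfl⟩
end

section
/- Let X and Y be Hausdorff topological spaces with Y compact, let g : Y → X be continuous and surjective, and let y ∈ Y. Then g is strictly open at y if and only if both of the following hold: (1) g⁻¹({g(y)}) = {y}; and (2) for every open set V ⊆ Y with y ∈ V, the set g(V) is a neighborhood of g(y) in X. -/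
/-- `g` is strictly open at `y` if the preimages `g ⁻¹' U` of open sets `U ∋ g y` form a
neighborhood base at `y`. -/
def StrictlyOpenAt {Y X : Type*} [TopologicalSpace Y] [TopologicalSpace X]
    (g : Y → X) (y : Y) : Prop :=
  (nhds y).HasBasis (fun U : Set X => IsOpen U ∧ g y ∈ U) (fun U => g ⁻¹' U)

/-- Let `X` and `Y` be Hausdorff spaces with `Y` compact, and let `g : Y → X`
be continuous and surjective.  Then `g` is strictly open at `y` if and only if the fiber of
`g y` is `{y}` and `g` maps open neighborhoods of `y` to neighborhoods of `g y`. -/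
theorem strictlyOpenAt_iff {X Y : Type*} [TopologicalSpace X] [TopologicalSpace Y]
    [T2Space X] [T2Space Y] [CompactSpace Y]
    (g : Y → X) (hg : Continuous g) (hsurj : Function.Surjective g) (y : Y) :
    StrictlyOpenAt g y ↔
      (g ⁻¹' {g y} = {y} ∧ ∀ V : Set Y, IsOpen V → y ∈ V → g '' V ∈ nhds (g y)) := by
  constructor
  · intro h
    refine ⟨?_, fun V hV hyV => ?_⟩
    · ext z
      simp only [Set.mem_preimage, Set.mem_singleton_iff]
      refine ⟨fun hz => ?_, fun hz => hz ▸ rfl⟩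
      by_contra hne
      obtain ⟨U, ⟨-, hyU⟩, hU⟩ := h.mem_iff.1 (isOpen_compl_singleton.mem_nhds (Ne.symm hne))
      exact hU (show g z ∈ U from hz ▸ hyU) rfl
    · obtain ⟨U, ⟨hUo, hyU⟩, hU⟩ := h.mem_iff.1 (hV.mem_nhds hyV)
      refine Filter.mem_of_superset (hUo.mem_nhds hyU) ?_
      rw [← Set.image_preimage_eq U hsurj]
      exact Set.image_mono hU
  · rintro ⟨hfib, -⟩
    refine ⟨fun t => ⟨fun ht => ?_, ?_⟩⟩
    · obtain ⟨V, hVt, hV, hyV⟩ := mem_nhds_iff.1 ht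
      refine ⟨(g '' Vᶜ)ᶜ, ⟨(hg.isClosedMap _ hV.isClosed_compl).isOpen_compl, ?_⟩, ?_⟩
      · rintro ⟨z, hzV, hz⟩
        have hzy : z ∈ ({y} : Set Y) := hfib ▸ hz
        exact hzV (Set.mem_singleton_iff.1 hzy ▸ hyV)
      · intro z hz
        by_contra hzt
        exact hz ⟨z, fun hzV => hzt (hVt hzV), rfl⟩
    · rintro ⟨U, ⟨hUo, hyU⟩, hU⟩
      exact Filter.mem_of_superset ((hUo.preimage hg).mem_nhds hyU) hU
end

section
/- Let X = [0,1], let Y = {(0,0)} ∪ ((0,1] × [0,1]) with the subspace topology from ℝ², let g : Y → X be the projection to the first coordinate, and let y = (0,0). Then: (1) g⁻¹({g(y)}) = {y}; (2) for every open set V ⊆ Y with y ∈ V, the set g(V) is a neighborhood of 0 in [0,1]; but (3) g is not strictly open at y. (Hence the compactness hypothesis in the characterization of strict openness cannot be dropped.) -/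
/-- The space `Y = {(0,0)} ∪ ((0,1] × [0,1]) ⊆ ℝ²`. -/
def Yspace : Set (ℝ × ℝ) := insert ((0 : ℝ), (0 : ℝ)) (Set.Ioc (0 : ℝ) 1 ×ˢ Set.Icc (0 : ℝ) 1)

/-- The space `X = [0,1]`. -/
def Xspace : Set ℝ := Set.Icc (0 : ℝ) 1

/-- With `X = [0,1]`, `Y = {(0,0)} ∪ ((0,1] × [0,1])`, `g : Y → X` the first
coordinate projection and `y = (0,0)`: the fiber of `g y` is `{y}`, images under `g` of open
neighborhoods of `y` are neighborhoods of `g y`, but `g` is *not* strictly open at `y`.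
Hence compactness cannot be dropped from the characterization of strict openness. -/
theorem not_strictlyOpenAt_counterexample (g : Yspace → Xspace)
    (hg : ∀ p : Yspace, (g p : ℝ) = (p : ℝ × ℝ).1)
    (y : Yspace) (hy : (y : ℝ × ℝ) = ((0 : ℝ), (0 : ℝ))) :
    g ⁻¹' {g y} = {y} ∧
      (∀ V : Set Yspace, IsOpen V → y ∈ V → g '' V ∈ nhds (g y)) ∧
      ¬ StrictlyOpenAt g y := by
  have hgy : (g y : ℝ) = 0 := by rw [hg, hy]
  refine ⟨?_, ?_, ?_⟩
  · ext p
    simp only [Set.mem_preimage, Set.mem_singleton_iff]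
    refine ⟨fun h => Subtype.ext ?_, fun h => h ▸ rfl⟩
    have h0 : (p : ℝ × ℝ).1 = 0 := by rw [← hg, h, hgy]
    rcases p.2 with hp | hp
    · exact hp.trans hy.symm
    · exact absurd h0 hp.1.1.ne'
  · intro V hV hyV
    have hmem (x : Xspace) : ((x : ℝ), (0 : ℝ)) ∈ Yspace := by
      rcases x.2.1.eq_or_lt with h | h
      · exact Or.inl (by rw [← h])
      · exact Or.inr ⟨⟨h, x.2.2⟩, ⟨le_rfl, zero_le_one⟩⟩
    let s : Xspace → Yspace := fun x => ⟨((x : ℝ), 0), hmem x⟩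
    have hs : Continuous s := by fun_prop
    have hsy : s (g y) = y := Subtype.ext (by simp [s, hgy, hy])
    filter_upwards [(hV.preimage hs).mem_nhds (show s (g y) ∈ V from hsy.symm ▸ hyV)] with x hx
    exact ⟨s x, hx, Subtype.ext (hg _)⟩
  · intro h
    have hV : {p : Yspace | (p : ℝ × ℝ).2 < 1} ∈ nhds y :=
      (isOpen_lt (by fun_prop) continuous_const).mem_nhds (by simp [hy])
    obtain ⟨U, ⟨hU, hyU⟩, hUV⟩ := h.mem_iff.mp hV
    obtain ⟨ε, hε, hball⟩ := Metric.isOpen_iff.mp hU _ hyU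
    have ht : 0 < min (ε / 2) 1 := lt_min (half_pos hε) one_pos
    let p : Yspace :=
      ⟨(min (ε / 2) 1, 1), Or.inr ⟨⟨ht, min_le_right _ _⟩, ⟨zero_le_one, le_rfl⟩⟩⟩
    have hp : g p ∈ U := by
      apply hball
      rw [Metric.mem_ball, Subtype.dist_eq, hgy, hg, Real.dist_eq, sub_zero, abs_of_pos ht]
      exact (min_le_left _ _).trans_lt (half_lt_self hε)
    exact lt_irrefl (1 : ℝ) (hUV hp)
end

section
/- Let X and Y be compact Hausdorff spaces, let h : X → X and k : Y → Y be homeomorphisms, and let g : Y → X be continuous and surjective with g ∘ k = h ∘ g. Suppose that h is minimal and that there is a dense subset S ⊆ Y such that g is strictly open at every point of S. Then k is minimal. -/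
/-- A map that semiconjugates two permutations semiconjugates their integer powers. -/
theorem semiconj_perm_zpow {X Y : Type*} {h : Equiv.Perm X} {k : Equiv.Perm Y} {g : Y → X}
    (hcomm : ∀ y, g (k y) = h (g y)) (n : ℤ) (y : Y) : g ((k ^ n) y) = (h ^ n) (g y) := by
  induction n generalizing y with
  | zero => simp
  | succ n ih => rw [zpow_add_one, zpow_add_one, Equiv.Perm.mul_apply, Equiv.Perm.mul_apply, ih,
      hcomm]
  | pred n ih =>
    rw [zpow_sub_one, zpow_sub_one, Equiv.Perm.mul_apply, Equiv.Perm.mul_apply, ih]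
    congr 1
    rw [Equiv.Perm.eq_inv_iff_eq, ← hcomm, ← Equiv.Perm.mul_apply, mul_inv_cancel, Equiv.Perm.one_apply]


/-- Let `X` and `Y` be compact Hausdorff spaces, `h : X ≃ₜ X`, `k : Y ≃ₜ Y`
homeomorphisms, and `g : Y → X` continuous surjective with `g ∘ k = h ∘ g`.  If `h` is minimal
and `g` is strictly open at every point of a dense subset `S ⊆ Y`, then `k` is minimal. -/
theorem minimal_of_extension {X Y : Type*} [TopologicalSpace X] [TopologicalSpace Y]
    [CompactSpace X] [CompactSpace Y] [T2Space X] [T2Space Y]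
    (h : X ≃ₜ X) (k : Y ≃ₜ Y) (g : Y → X) (hg : Continuous g)
    (hsurj : Function.Surjective g) (hcomm : ∀ y : Y, g (k y) = h (g y))
    (hmin : ∀ x : X, Dense (Set.range fun n : ℤ => (h.toEquiv ^ n) x))
    (S : Set Y) (hS : Dense S) (hstr : ∀ y ∈ S, StrictlyOpenAt g y) :
    ∀ y : Y, Dense (Set.range fun n : ℤ => (k.toEquiv ^ n) y) := by
  intro y
  rw [dense_iff_inter_open]
  rintro V hV hVne
  obtain ⟨s, hsV, hsS⟩ := hS.inter_open_nonempty V hV hVne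
  obtain ⟨U, ⟨hU, hsU⟩, hUV⟩ := (hstr s hsS).mem_iff.1 (hV.mem_nhds hsV)
  obtain ⟨_, hnU, n, rfl⟩ := (hmin (g y)).inter_open_nonempty U hU ⟨g s, hsU⟩
  refine ⟨(k.toEquiv ^ n) y, hUV ?_, n, rfl⟩
  rw [Set.mem_preimage, semiconj_perm_zpow hcomm n y]
  exact hnU
end

section
/- Fix an irrational number θ. Let S¹ ⊆ ℂ be the unit circle, let h : S¹ → S¹ be h(ζ) = e^{2πiθ}ζ, and let Y = (S¹ × {0}) ∪ {(e^{2πinθ}, 1/(|n|+1)) : n ∈ ℤ} ⊆ S¹ × [0,1]. Define k : Y → Y by k(ζ, 0) = (e^{2πiθ}ζ, 0) and k(e^{2πinθ}, 1/(|n|+1)) = (e^{2πi(n+1)θ}, 1/(|n+1|+1)), and let g : Y → S¹ be the projection to the first coordinate. Then: Y is compact; k is a well-defined homeomorphism of Y; g is continuous and surjective; g ∘ k = h ∘ g; h is minimal; k is not minimal; g⁻¹({ζ}) has at most two points for every ζ ∈ S¹; and g⁻¹({ζ}) has exactly one point for all but countably many ζ ∈ S¹. -/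
open Circle

/-- The points of height `1 / (|n| + 1)` above the orbit of `1` under the rotation by `z`. -/
noncomputable def liftedOrbit (z : Circle) (n : ℤ) : Circle × ℝ :=
  (z ^ n, 1 / (|(n : ℝ)| + 1))

/-- The circle at height zero together with the lifted orbit points indexed by `A`. -/
def circleWithOrbit (z : Circle) (A : Set ℤ) : Set (Circle × ℝ) :=
  Set.univ ×ˢ {(0 : ℝ)} ∪ liftedOrbit z '' A

lemma liftedOrbit_snd_pos (z : Circle) (n : ℤ) : 0 < (liftedOrbit z n).2 := by
  simp only [liftedOrbit]; positivity

lemma circleWithOrbit_eq_iInter (z : Circle) (A : Set ℤ) :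
    circleWithOrbit z A = ⋂ N : ℕ, (Set.univ ×ˢ Set.Icc (0 : ℝ) (1 / ((N : ℝ) + 1)) ∪
      liftedOrbit z '' (A ∩ Set.Icc (-(N : ℤ)) N)) := by
  ext p
  simp only [Set.mem_iInter]
  constructor
  · rintro (⟨-, hp⟩ | ⟨n, hn, rfl⟩) N
    · rw [Set.mem_singleton_iff] at hp
      exact Or.inl ⟨trivial, by rw [hp]; exact ⟨le_rfl, by positivity⟩⟩
    · by_cases hN : |n| ≤ N
      · exact Or.inr ⟨n, ⟨hn, abs_le.mp hN⟩, rfl⟩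
      · refine Or.inl ⟨trivial, (liftedOrbit_snd_pos z n).le, ?_⟩
        have h : (N : ℝ) ≤ |(n : ℝ)| := by exact_mod_cast (not_le.mp hN).le
        simp only [liftedOrbit]
        gcongr
  · intro h
    by_cases hp : p.2 ≤ 0
    · rcases h 0 with ⟨-, h0⟩ | ⟨n, hn, rfl⟩
      · exact Or.inl ⟨trivial, le_antisymm hp h0.1⟩
      · exact Or.inr ⟨n, hn.1, rfl⟩
    · obtain ⟨N, hN⟩ := exists_nat_one_div_lt (not_le.mp hp)
      rcases h N with ⟨-, hle⟩ | ⟨n, hn, rfl⟩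
      · exact absurd hle.2 (not_le.mpr hN)
      · exact Or.inr ⟨n, hn.1, rfl⟩

lemma isCompact_circleWithOrbit (z : Circle) (A : Set ℤ) :
    IsCompact (circleWithOrbit z A) := by
  have hK (N : ℕ) : IsCompact (Set.univ ×ˢ Set.Icc (0 : ℝ) (1 / ((N : ℝ) + 1)) ∪
      liftedOrbit z '' (A ∩ Set.Icc (-(N : ℤ)) N)) :=
    (isCompact_univ.prod isCompact_Icc).union
      (((Set.finite_Icc _ _).inter_of_right A).image _).isCompact
  rw [circleWithOrbit_eq_iInter]
  exact (hK 0).of_isClosed_subset (isClosed_iInter fun N => (hK N).isClosed)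
    (Set.iInter_subset _ 0)

lemma liftedOrbit_injective {z : Circle} (hz : Function.Injective fun n : ℤ => z ^ n) :
    Function.Injective (liftedOrbit z) :=
  fun _ _ h => hz (congrArg Prod.fst h)

/-- The space `circleWithOrbit z univ` is the disjoint union, as a set, of the circle and `ℤ`. -/
noncomputable def circleSumIntEquiv {z : Circle} (hz : Function.Injective fun n : ℤ => z ^ n) :
    Circle ⊕ ℤ ≃ circleWithOrbit z Set.univ :=
  Equiv.ofBijective
    (Sum.elim (fun ζ => ⟨(ζ, 0), Or.inl ⟨trivial, rfl⟩⟩)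
      (fun n => ⟨liftedOrbit z n, Or.inr ⟨n, trivial, rfl⟩⟩)) <| by
    constructor
    · rintro (ζ | n) (ξ | m) h <;> have h' := congrArg Subtype.val h
      · exact congrArg Sum.inl (congrArg Prod.fst h')
      · exact absurd (congrArg Prod.snd h') (liftedOrbit_snd_pos z m).ne
      · exact absurd (congrArg Prod.snd h') (liftedOrbit_snd_pos z n).ne'
      · exact congrArg Sum.inr (liftedOrbit_injective hz h')
    · rintro ⟨⟨ζ, t⟩, (⟨-, ht⟩ | ⟨n, -, hn⟩)⟩
      · exact ⟨Sum.inl ζ, Subtype.ext (Prod.ext rfl (Set.mem_singleton_iff.mp ht).symm)⟩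
      · exact ⟨Sum.inr n, Subtype.ext hn⟩

section Shift

variable {z : Circle} (hz : Function.Injective fun n : ℤ => z ^ n)

@[simp] lemma circleSumIntEquiv_inl (ζ : Circle) :
    (circleSumIntEquiv hz (Sum.inl ζ) : Circle × ℝ) = (ζ, 0) := rfl

@[simp] lemma circleSumIntEquiv_inr (n : ℤ) :
    (circleSumIntEquiv hz (Sum.inr n) : Circle × ℝ) = liftedOrbit z n := rfl

/-- Rotate the circle by `z ^ m` and shift the lifted orbit by `m`. -/
noncomputable def shiftEquiv (m : ℤ) : Equiv.Perm (circleWithOrbit z Set.univ) :=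
  (circleSumIntEquiv hz).permCongr
    (Equiv.sumCongr (Equiv.mulLeft (z ^ m)) (Equiv.addRight m))

lemma shiftEquiv_inl (m : ℤ) (ζ : Circle) :
    shiftEquiv hz m (circleSumIntEquiv hz (Sum.inl ζ)) =
      circleSumIntEquiv hz (Sum.inl (z ^ m * ζ)) := by
  simp [shiftEquiv, Equiv.permCongr_apply]

lemma shiftEquiv_inr (m n : ℤ) :
    shiftEquiv hz m (circleSumIntEquiv hz (Sum.inr n)) =
      circleSumIntEquiv hz (Sum.inr (n + m)) := by
  simp [shiftEquiv, Equiv.permCongr_apply]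

lemma shiftEquiv_symm (m : ℤ) : (shiftEquiv hz m).symm = shiftEquiv hz (-m) := by
  ext1 p
  rw [Equiv.symm_apply_eq]
  obtain ⟨ζ | n, rfl⟩ := (circleSumIntEquiv hz).surjective p
  · simp [shiftEquiv_inl]
  · simp [shiftEquiv_inr]

lemma shiftEquiv_fst (m : ℤ) (p : circleWithOrbit z Set.univ) :
    (shiftEquiv hz m p : Circle × ℝ).1 = z ^ m * (p : Circle × ℝ).1 := by
  obtain ⟨ζ | n, rfl⟩ := (circleSumIntEquiv hz).surjective p
  · simp [shiftEquiv_inl]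
  · simp [shiftEquiv_inr, liftedOrbit, zpow_add, mul_comm]

lemma shiftEquiv_snd_nonneg (m : ℤ) (p : circleWithOrbit z Set.univ) :
    0 ≤ (shiftEquiv hz m p : Circle × ℝ).2 := by
  obtain ⟨ζ | n, rfl⟩ := (circleSumIntEquiv hz).surjective p
  · simp [shiftEquiv_inl]
  · simpa [shiftEquiv_inr] using (liftedOrbit_snd_pos z (n + m)).le

lemma shiftEquiv_snd_le (m : ℤ) (p : circleWithOrbit z Set.univ) :
    (shiftEquiv hz m p : Circle × ℝ).2 ≤ (|(m : ℝ)| + 1) * (p : Circle × ℝ).2 := by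
  obtain ⟨ζ | n, rfl⟩ := (circleSumIntEquiv hz).surjective p
  · simp [shiftEquiv_inl]
  · simp only [shiftEquiv_inr, circleSumIntEquiv_inr, liftedOrbit, Int.cast_add]
    rw [mul_one_div, div_le_div_iff₀ (by positivity) (by positivity)]
    have h : |(n : ℝ)| ≤ |(n : ℝ) + m| + |(m : ℝ)| := by
      simpa using abs_sub ((n : ℝ) + m) m
    nlinarith [mul_nonneg (abs_nonneg (m : ℝ)) (abs_nonneg ((n : ℝ) + m))]

lemma isOpen_singleton_liftedOrbit (n : ℤ) :
    IsOpen {circleSumIntEquiv hz (Sum.inr n)} := by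
  rw [← isClosed_compl_iff]
  have hval : Continuous fun p : circleWithOrbit z Set.univ => (p : Circle × ℝ) :=
    continuous_subtype_val
  convert (isCompact_circleWithOrbit z {n}ᶜ).isClosed.preimage hval using 1
  ext p
  obtain ⟨x, rfl⟩ := (circleSumIntEquiv hz).surjective p
  rw [Set.mem_compl_iff, Set.mem_singleton_iff, Set.mem_preimage, EmbeddingLike.apply_eq_iff_eq]
  rcases x with ζ | m
  · rw [circleSumIntEquiv_inl]
    simp [circleWithOrbit]
  · rw [circleSumIntEquiv_inr]
    simp [circleWithOrbit, (liftedOrbit_snd_pos z m).ne', (liftedOrbit_injective hz).eq_iff]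

lemma continuous_shiftEquiv (m : ℤ) : Continuous (shiftEquiv hz m) := by
  have hfst : Continuous fun p => (shiftEquiv hz m p : Circle × ℝ).1 := by
    simp only [shiftEquiv_fst]
    fun_prop
  refine continuous_induced_rng.mpr (hfst.prodMk (continuous_iff_continuousAt.mpr fun p => ?_))
  obtain ⟨ζ | n, rfl⟩ := (circleSumIntEquiv hz).surjective p
  · have hlim : Filter.Tendsto
        (fun p : circleWithOrbit z Set.univ => (|(m : ℝ)| + 1) * (p : Circle × ℝ).2)
        (nhds (circleSumIntEquiv hz (Sum.inl ζ))) (nhds 0) := by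
      have hc : Continuous fun p : circleWithOrbit z Set.univ =>
          (|(m : ℝ)| + 1) * (p : Circle × ℝ).2 := by fun_prop
      simpa using hc.tendsto (circleSumIntEquiv hz (Sum.inl ζ))
    simpa [ContinuousAt, shiftEquiv_inl] using
      squeeze_zero (shiftEquiv_snd_nonneg hz m) (shiftEquiv_snd_le hz m) hlim
  · rw [ContinuousAt, (isOpen_singleton_iff_nhds_eq_pure _).mp (isOpen_singleton_liftedOrbit hz n)]
    exact tendsto_pure_nhds _ _

/-- The shift of the circle with its lifted orbit, as a homeomorphism. -/
noncomputable def shiftHomeomorph (m : ℤ) :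
    circleWithOrbit z Set.univ ≃ₜ circleWithOrbit z Set.univ where
  toEquiv := shiftEquiv hz m
  continuous_toFun := continuous_shiftEquiv hz m
  continuous_invFun := by
    change Continuous (shiftEquiv hz m).symm
    rw [shiftEquiv_symm]
    exact continuous_shiftEquiv hz (-m)

lemma shiftEquiv_zpow_inl (m n : ℤ) (ζ : Circle) :
    ∃ ξ, (shiftEquiv hz m ^ n) (circleSumIntEquiv hz (Sum.inl ζ)) =
      circleSumIntEquiv hz (Sum.inl ξ) := by
  induction n generalizing ζ with
  | zero => exact ⟨ζ, rfl⟩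
  | succ n ih =>
    rw [zpow_add_one, Equiv.Perm.mul_apply, shiftEquiv_inl]
    exact ih _
  | pred n ih =>
    rw [zpow_sub_one, Equiv.Perm.mul_apply, Equiv.Perm.inv_def, shiftEquiv_symm, shiftEquiv_inl]
    exact ih _

lemma not_dense_range_shiftEquiv_zpow (m : ℤ) (ζ : Circle) :
    ¬ Dense (Set.range fun n : ℤ =>
      (shiftEquiv hz m ^ n) (circleSumIntEquiv hz (Sum.inl ζ))) := by
  intro h
  obtain ⟨_, rfl, n, hn⟩ :=
    h.inter_open_nonempty _ (isOpen_singleton_liftedOrbit hz 0) (Set.singleton_nonempty _)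
  obtain ⟨ξ, hξ⟩ := shiftEquiv_zpow_inl hz m n ζ
  simpa using hξ.symm.trans hn

lemma preimage_fst_subset (ζ : Circle) :
    {p : circleWithOrbit z Set.univ | (p : Circle × ℝ).1 = ζ} ⊆
      insert (circleSumIntEquiv hz (Sum.inl ζ))
        ((fun n => circleSumIntEquiv hz (Sum.inr n)) '' {n | z ^ n = ζ}) := by
  rintro p rfl
  obtain ⟨ξ | n, rfl⟩ := (circleSumIntEquiv hz).surjective p
  · exact Or.inl rfl
  · exact Or.inr ⟨n, rfl, rfl⟩

end Shift

lemma encard_preimage_fst_le_two {z : Circle}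
    (hz : Function.Injective fun n : ℤ => z ^ n) (ζ : Circle) :
    {p : circleWithOrbit z Set.univ | (p : Circle × ℝ).1 = ζ}.encard ≤ 2 := by
  have hsub : {n : ℤ | z ^ n = ζ}.Subsingleton := fun a ha b hb => hz (ha.trans hb.symm)
  calc _ ≤ _ := Set.encard_le_encard (preimage_fst_subset hz ζ)
    _ ≤ _ := Set.encard_insert_le _ _
    _ ≤ 1 + 1 := by
      gcongr
      exact Set.encard_le_one_iff_subsingleton.mpr (hsub.image _)
    _ = 2 := one_add_one_eq_two

lemma encard_preimage_fst_eq_one {z : Circle}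
    (hz : Function.Injective fun n : ℤ => z ^ n) {ζ : Circle}
    (hζ : ζ ∉ Set.range fun n : ℤ => z ^ n) :
    {p : circleWithOrbit z Set.univ | (p : Circle × ℝ).1 = ζ}.encard = 1 := by
  have hempty : {n : ℤ | z ^ n = ζ} = ∅ := by
    ext n
    simpa using fun h => hζ ⟨n, h⟩
  refine Set.encard_eq_one.mpr ⟨circleSumIntEquiv hz (Sum.inl ζ), Set.Subset.antisymm ?_ ?_⟩
  · simpa [hempty] using preimage_fst_subset hz ζ
  · rintro _ rfl
    rfl

lemma Circle.injective_zpow_exp {θ : ℝ} (hθ : Irrational θ) :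
    Function.Injective fun n : ℤ => Circle.exp (2 * Real.pi * θ) ^ n := by
  intro a b h
  simp only [← Circle.exp_intCast_mul] at h
  obtain ⟨m, hm⟩ := Circle.exp_eq_exp.mp h
  by_contra hab
  have hab' : (a : ℝ) - b ≠ 0 := sub_ne_zero.mpr (by exact_mod_cast hab)
  have hπ : (2 * Real.pi) * (θ * (a - b)) = 2 * Real.pi * m := by linear_combination hm
  have hm' := mul_left_cancel₀ Real.two_pi_pos.ne' hπ
  exact hθ ⟨m / (a - b), by push_cast; rw [div_eq_iff hab', hm']⟩

lemma Circle.dense_range_zpow_exp_mul {θ : ℝ} (hθ : Irrational θ) (ζ : Circle) :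
    Dense (Set.range fun n : ℤ => Circle.exp (2 * Real.pi * θ) ^ n * ζ) := by
  have hd : DenseRange (· • (2 * Real.pi * θ : ℝ) : ℤ → AddCircle (2 * Real.pi)) :=
    AddCircle.denseRange_zsmul_coe_iff.mpr
      (by rwa [mul_div_cancel_left₀ _ Real.two_pi_pos.ne'])
  let e := AddCircle.homeomorphCircle'.trans (Homeomorph.mulRight ζ)
  have hcomp : (fun n : ℤ => Circle.exp (2 * Real.pi * θ) ^ n * ζ) =
      e ∘ fun n : ℤ => n • ((2 * Real.pi * θ : ℝ) : AddCircle (2 * Real.pi)) := by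
    funext n
    rw [← Circle.exp_zsmul]
    rfl
  rw [hcomp]
  exact e.surjective.denseRange.comp hd e.continuous

/-- Fix an irrational `θ`, let `z = e^{2πiθ}`, `h : S¹ → S¹` the rotation
`ζ ↦ z * ζ`, and `Y = (S¹ × {0}) ∪ {(zⁿ, 1/(|n|+1)) : n ∈ ℤ} ⊆ S¹ × [0,1]`, with
`k : Y → Y` given by `k (ζ, 0) = (z ζ, 0)` and `k (zⁿ, 1/(|n|+1)) = (z^{n+1}, 1/(|n+1|+1))`,
and `g : Y → S¹` the first-coordinate projection.  Then `Y` is compact; `k` is a well-defined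
homeomorphism; `g` is continuous and surjective; `g ∘ k = h ∘ g`; `h` is minimal; `k` is not
minimal; every fiber of `g` has at most two points; and all but countably many fibers of `g`
are singletons. -/
theorem denjoy_like_counterexample (θ : ℝ) (hθ : Irrational θ)
    (z : Circle) (hz : z = Circle.exp (2 * Real.pi * θ))
    (Y : Set (Circle × ℝ))
    (hY : Y = (Set.univ ×ˢ {(0 : ℝ)}) ∪
      (Set.range fun n : ℤ => ((z ^ n : Circle), (1 / ((|n| : ℝ) + 1) : ℝ))))
    (g : Y → Circle) (hg : ∀ p : Y, g p = (p : Circle × ℝ).1) :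
    IsCompact Y ∧
    (∃ k : Y ≃ₜ Y,
      (∀ p : Y, (p : Circle × ℝ).2 = 0 →
        ((k p : Circle × ℝ)) = (z * (p : Circle × ℝ).1, (0 : ℝ))) ∧
      (∀ (n : ℤ) (p : Y), (p : Circle × ℝ) = ((z ^ n : Circle), (1 / ((|n| : ℝ) + 1) : ℝ)) →
        ((k p : Circle × ℝ)) = ((z ^ (n + 1) : Circle), (1 / ((|n + 1| : ℝ) + 1) : ℝ))) ∧
      (∀ p : Y, g (k p) = z * g p) ∧
      ¬ (∀ y : Y, Dense (Set.range fun n : ℤ => (k.toEquiv ^ n) y))) ∧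
    Continuous g ∧
    Function.Surjective g ∧
    (∀ ζ : Circle, Dense (Set.range fun n : ℤ => z ^ n * ζ)) ∧
    (∀ ζ : Circle, (g ⁻¹' {ζ}).encard ≤ 2) ∧
    Set.Countable {ζ : Circle | (g ⁻¹' {ζ}).encard ≠ 1} := by
  have hinj : Function.Injective fun n : ℤ => z ^ n := hz ▸ Circle.injective_zpow_exp hθ
  obtain rfl : Y = circleWithOrbit z Set.univ := by
    rw [hY, circleWithOrbit, Set.image_univ]
    rfl
  have hfib (ζ : Circle) :
      g ⁻¹' {ζ} = {p : circleWithOrbit z Set.univ | (p : Circle × ℝ).1 = ζ} := by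
    ext p
    simp [hg]
  have hgc : Continuous g := by
    rw [funext hg]
    fun_prop
  refine ⟨isCompact_circleWithOrbit z _,
    ⟨shiftHomeomorph hinj 1, fun p hp => ?_, fun n p hp => ?_, fun p => ?_, fun h => ?_⟩,
    hgc, fun ζ => ⟨circleSumIntEquiv hinj (Sum.inl ζ), hg _⟩,
    hz ▸ Circle.dense_range_zpow_exp_mul hθ, fun ζ => ?_, ?_⟩
  · obtain ⟨ζ, rfl⟩ : ∃ ζ, p = circleSumIntEquiv hinj (Sum.inl ζ) :=
      ⟨_, Subtype.ext (Prod.ext rfl hp)⟩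
    change (shiftEquiv hinj 1 _ : Circle × ℝ) = _
    simp [shiftEquiv_inl]
  · obtain rfl : p = circleSumIntEquiv hinj (Sum.inr n) := Subtype.ext hp
    change (shiftEquiv hinj 1 _ : Circle × ℝ) = _
    simp [shiftEquiv_inr, liftedOrbit]
  · rw [hg, hg]
    exact (shiftEquiv_fst hinj 1 p).trans (by rw [zpow_one])
  · exact not_dense_range_shiftEquiv_zpow hinj 1 1 (h _)
  · rw [hfib]
    exact encard_preimage_fst_le_two hinj ζ
  · refine (Set.countable_range fun n : ℤ => z ^ n).mono fun ζ hζ => ?_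
    by_contra hn
    exact hζ (by rw [hfib]; exact encard_preimage_fst_eq_one hinj hn)
end

section
/- Let A be a unital C*-algebra with real rank zero, and let τ be a tracial state on A. For each n, let τ_n = Tr ⊗ τ denote the induced unnormalized trace on the matrix algebra M_n(A). Suppose that whenever p ∈ M_m(A) and q ∈ M_n(A) are projections with τ_m(p) < τ_n(q), then p is Cuntz subequivalent to q (after embedding both into a common matrix algebra over A). Then τ is the only tracial state on A. -/
open scoped ComplexOrder
open Matrix

/-- A unital C*-algebra has real rank zero if the invertible self-adjoint elements are dense in
the self-adjoint elements. -/
def RealRankZero (A : Type*) [CStarAlgebra A] : Prop :=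
  Dense {a : selfAdjoint A | IsUnit (a : A)}

/-- A tracial state on a unital C*-algebra: a unital positive linear functional `τ` with
`τ (a * b) = τ (b * a)`. -/
def IsTracialState {A : Type*} [CStarAlgebra A] [PartialOrder A] [StarOrderedRing A]
    (τ : A →ₗ[ℂ] ℂ) : Prop :=
  τ 1 = 1 ∧ (∀ a : A, 0 ≤ a → 0 ≤ τ a) ∧ ∀ a b : A, τ (a * b) = τ (b * a)

/-- The induced unnormalized trace `Tr ⊗ τ` on `Mₙ(A)`. -/
noncomputable def matTrace {A : Type*} [CStarAlgebra A] (τ : A →ₗ[ℂ] ℂ) {n : ℕ}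
    (M : Matrix (Fin n) (Fin n) A) : ℂ :=
  ∑ i, τ (M i i)

/-- A projection: a self-adjoint idempotent. -/
def IsProjection {R : Type*} [Mul R] [Star R] (p : R) : Prop :=
  p * p = p ∧ star p = p

/-- Cuntz subequivalence of a matrix over `A` to another matrix over `A` (of possibly different
size), witnessed by rectangular matrices; this is Cuntz subequivalence after embedding both
into a common matrix algebra over `A`. -/
def CuntzLE {A : Type*} [CStarAlgebra A] {m n : ℕ}
    (a : Matrix (Fin m) (Fin m) A) (b : Matrix (Fin n) (Fin n) A) : Prop :=
  ∃ v : ℕ → Matrix (Fin m) (Fin n) A,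
    Filter.Tendsto (fun k => v k * b * (v k)ᴴ) Filter.atTop (nhds a)

namespace IsTracialState

variable {A : Type*} [CStarAlgebra A] [PartialOrder A] [StarOrderedRing A] {τ : A →ₗ[ℂ] ℂ}

/-- A tracial state, bundled as a positive linear map. -/
noncomputable def toPositiveLinearMap (hτ : IsTracialState τ) : A →ₚ[ℂ] ℂ :=
  PositiveLinearMap.mk₀ τ hτ.2.1

lemma exists_norm_apply_le (hτ : IsTracialState τ) : ∃ C : ℝ, ∀ a, ‖τ a‖ ≤ C * ‖a‖ := by
  obtain ⟨C, hC⟩ := hτ.toPositiveLinearMap.exists_norm_apply_le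
  exact ⟨C, hC⟩

lemma continuous (hτ : IsTracialState τ) : Continuous τ :=
  (LinearMap.mkContinuousOfExistsBound τ hτ.exists_norm_apply_le).continuous

lemma norm_apply_le_of_nonneg (hτ : IsTracialState τ) {a : A} (ha : 0 ≤ a) : ‖τ a‖ ≤ ‖a‖ := by
  have h : ‖τ a‖ ≤ ‖τ 1‖ * ‖a‖ := hτ.toPositiveLinearMap.norm_apply_le_of_nonneg a ha
  simpa [hτ.1] using h

lemma matTrace_mul_comm (hτ : IsTracialState τ) {m n : ℕ} (v : Matrix (Fin m) (Fin n) A)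
    (w : Matrix (Fin n) (Fin m) A) : matTrace τ (v * w) = matTrace τ (w * v) := by
  simp only [matTrace, Matrix.mul_apply, map_sum]
  rw [Finset.sum_comm]
  exact Finset.sum_congr rfl fun j _ => Finset.sum_congr rfl fun i _ => hτ.2.2 _ _

lemma continuous_matTrace (hτ : IsTracialState τ) {n : ℕ} :
    Continuous (matTrace τ : Matrix (Fin n) (Fin n) A → ℂ) :=
  continuous_finsetSum _ fun i _ => hτ.continuous.comp (continuous_id.matrix_elem i i)

end IsTracialState

section Projection

lemma IsProjection.norm_le_one {A : Type*} [NonUnitalCStarAlgebra A] {p : A}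
    (hp : IsProjection p) : ‖p‖ ≤ 1 := by
  have h := CStarRing.norm_star_mul_self (x := p)
  rw [hp.2, hp.1] at h
  nlinarith [norm_nonneg p]

lemma IsProjection.one_sub {R : Type*} [Ring R] [StarRing R] {p : R} (hp : IsProjection p) :
    IsProjection (1 - p) := by
  refine ⟨?_, by rw [star_sub, star_one, hp.2]⟩
  simp [sub_mul, mul_sub, hp.1]

lemma IsProjection.nonneg {A : Type*} [CStarAlgebra A] [PartialOrder A] [StarOrderedRing A] {p : A}
    (hp : IsProjection p) : 0 ≤ p := by
  have h := star_mul_self_nonneg p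
  rwa [hp.2, hp.1] at h

lemma IsProjection.diagonal {R : Type*} [Ring R] [StarRing R] {p : R} (hp : IsProjection p)
    (n : ℕ) : IsProjection (Matrix.diagonal fun _ : Fin n => p) := by
  refine ⟨by rw [Matrix.diagonal_mul_diagonal, hp.1], ?_⟩
  rw [Matrix.star_eq_conjTranspose, Matrix.diagonal_conjTranspose]
  congr 1
  funext _
  exact hp.2

end Projection

section Comparison

variable {A : Type*} [CStarAlgebra A] {m n : ℕ}

/-- A square matrix, extended by zero to a larger matrix. -/
noncomputable def cornerEmbedding (n : ℕ) (a : Matrix (Fin m) (Fin m) A) :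
    CStarMatrix (Fin m ⊕ Fin n) (Fin m ⊕ Fin n) A :=
  CStarMatrix.ofMatrix (Matrix.fromBlocks a 0 0 0)

lemma continuous_cornerEmbedding :
    Continuous (cornerEmbedding n : Matrix (Fin m) (Fin m) A → _) := by
  have h : Continuous fun a : Matrix (Fin m) (Fin m) A =>
      (Matrix.fromBlocks a 0 0 0 : Matrix (Fin m ⊕ Fin n) (Fin m ⊕ Fin n) A) :=
    continuous_id.matrix_fromBlocks continuous_const continuous_const continuous_const
  exact CStarMatrix.uniformEmbedding_ofMatrix.uniformContinuous.continuous.comp h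

variable [PartialOrder A] [StarOrderedRing A]

lemma norm_conjTranspose_mul_self_apply_le (v : Matrix (Fin m) (Fin n) A) (j : Fin n) :
    ‖(vᴴ * v) j j‖ ≤ ‖cornerEmbedding n (v * vᴴ)‖ := by
  let b : Matrix (Fin m ⊕ Fin n) (Fin m ⊕ Fin n) A := Matrix.fromBlocks 0 v 0 0
  let w : CStarMatrix (Fin m ⊕ Fin n) (Fin m ⊕ Fin n) A := CStarMatrix.ofMatrix b
  have h₁ : w * star w = cornerEmbedding n (v * vᴴ) := by
    change CStarMatrix.ofMatrix (b * bᴴ) = _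
    simp [b, cornerEmbedding, Matrix.fromBlocks_conjTranspose, Matrix.fromBlocks_multiply]
  have h₂ : star w * w = CStarMatrix.ofMatrix (Matrix.fromBlocks 0 0 0 (vᴴ * v)) := by
    change CStarMatrix.ofMatrix (bᴴ * b) = _
    simp [b, Matrix.fromBlocks_conjTranspose, Matrix.fromBlocks_multiply]
  rw [← h₁, CStarRing.norm_self_mul_star, ← CStarRing.norm_star_mul_self, h₂]
  exact CStarMatrix.norm_entry_le_norm
    (M := CStarMatrix.ofMatrix (Matrix.fromBlocks 0 0 0 (vᴴ * v))) (i := Sum.inr j) (j := Sum.inr j)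

lemma norm_cornerEmbedding_le_one {p : Matrix (Fin m) (Fin m) A} (hp : IsProjection p) :
    ‖cornerEmbedding n p‖ ≤ 1 := by
  refine IsProjection.norm_le_one ⟨?_, ?_⟩
  · change CStarMatrix.ofMatrix (Matrix.fromBlocks p 0 0 0 * Matrix.fromBlocks p 0 0 0) = _
    simp [Matrix.fromBlocks_multiply, hp.1, cornerEmbedding]
  · change CStarMatrix.ofMatrix (Matrix.fromBlocks p 0 0 0)ᴴ = _
    have h : pᴴ = p := hp.2
    simp [Matrix.fromBlocks_conjTranspose, h, cornerEmbedding]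

/-- A projection that is Cuntz subequivalent to the identity of size `n` has trace at most `n`. -/
lemma IsTracialState.re_matTrace_le_of_cuntzLE_one {σ : A →ₗ[ℂ] ℂ} (hσ : IsTracialState σ)
    {p : Matrix (Fin m) (Fin m) A} (hp : IsProjection p)
    (h : CuntzLE p (1 : Matrix (Fin n) (Fin n) A)) : (matTrace σ p).re ≤ n := by
  obtain ⟨v, hv⟩ := h
  simp only [Matrix.mul_one] at hv
  have h₁ := (Complex.continuous_re.comp hσ.continuous_matTrace).continuousAt.tendsto.comp hv
  have h₂ := ((continuous_cornerEmbedding (A := A) (m := m) (n := n)).norm.const_mul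
    (n : ℝ)).continuousAt.tendsto.comp hv
  have h₃ : (matTrace σ p).re ≤ n * ‖cornerEmbedding n p‖ := by
    refine le_of_tendsto_of_tendsto' h₁ h₂ fun k => ?_
    calc (matTrace σ (v k * (v k)ᴴ)).re = (matTrace σ ((v k)ᴴ * v k)).re := by
          rw [hσ.matTrace_mul_comm]
      _ ≤ ‖matTrace σ ((v k)ᴴ * v k)‖ := Complex.re_le_norm _
      _ ≤ ∑ _j : Fin n, ‖cornerEmbedding n (v k * (v k)ᴴ)‖ := by
          refine norm_sum_le_of_le _ fun j _ => ?_
          refine (hσ.norm_apply_le_of_nonneg ?_).trans (norm_conjTranspose_mul_self_apply_le _ j)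
          simp only [Matrix.mul_apply, Matrix.conjTranspose_apply]
          exact Finset.sum_nonneg fun i _ => star_mul_self_nonneg _
      _ = n * ‖cornerEmbedding n (v k * (v k)ᴴ)‖ := by simp
  exact h₃.trans (mul_le_of_le_one_right n.cast_nonneg (norm_cornerEmbedding_le_one hp))

lemma IsTracialState.re_apply_le_of_comparison {τ σ : A →ₗ[ℂ] ℂ} (hτ : IsTracialState τ)
    (hcomp : ∀ (m n : ℕ) (p : Matrix (Fin m) (Fin m) A) (q : Matrix (Fin n) (Fin n) A),
      IsProjection p → IsProjection q → matTrace τ p < matTrace τ q → CuntzLE p q)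
    (hσ : IsTracialState σ) {p : A} (hp : IsProjection p) : (σ p).re ≤ (τ p).re := by
  by_contra! hlt
  obtain ⟨n, hn⟩ := exists_nat_gt (1 / ((σ p).re - (τ p).re))
  rw [div_lt_iff₀ (sub_pos.2 hlt)] at hn
  have hpos := Complex.nonneg_iff.1 (hτ.2.1 p hp.nonneg)
  have hfloor := Nat.floor_le (mul_nonneg n.cast_nonneg hpos.1)
  have hfloor' := Nat.lt_floor_add_one ((n : ℝ) * (τ p).re)
  have hle := hσ.re_matTrace_le_of_cuntzLE_one (hp.diagonal n) <|
    hcomp n (⌊(n : ℝ) * (τ p).re⌋₊ + 1) _ 1 (hp.diagonal n) ⟨one_mul 1, star_one _⟩ <| by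
      rw [Complex.lt_def]
      simpa [matTrace, hτ.1, ← hpos.2] using hfloor'
  simp only [matTrace, Matrix.diagonal_apply_eq, Finset.sum_const, Finset.card_univ,
    Fintype.card_fin, nsmul_eq_mul, Complex.mul_re, Complex.natCast_re, Complex.natCast_im,
    zero_mul, sub_zero] at hle
  push_cast at hle
  linarith

lemma IsTracialState.apply_eq_of_comparison {τ σ : A →ₗ[ℂ] ℂ} (hτ : IsTracialState τ)
    (hcomp : ∀ (m n : ℕ) (p : Matrix (Fin m) (Fin m) A) (q : Matrix (Fin n) (Fin n) A),
      IsProjection p → IsProjection q → matTrace τ p < matTrace τ q → CuntzLE p q)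
    (hσ : IsTracialState σ) {p : A} (hp : IsProjection p) : σ p = τ p := by
  have h₁ := hτ.re_apply_le_of_comparison hcomp hσ hp
  have h₂ := hτ.re_apply_le_of_comparison hcomp hσ hp.one_sub
  simp only [map_sub, hσ.1, hτ.1, Complex.sub_re, Complex.one_re] at h₂
  have h₃ := (Complex.nonneg_iff.1 (hσ.2.1 p hp.nonneg)).2
  have h₄ := (Complex.nonneg_iff.1 (hτ.2.1 p hp.nonneg)).2
  exact Complex.ext (by linarith) (h₃.symm.trans h₄)

end Comparison

section RealRankZero

variable {A : Type*} [CStarAlgebra A]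

/-- An invertible self-adjoint element is within half its norm of a multiple of a self-adjoint
unitary. -/
lemma IsSelfAdjoint.exists_symmetry_norm_sub_le {b : A} (hb : IsSelfAdjoint b) (hu : IsUnit b) :
    ∃ s : A, IsSelfAdjoint s ∧ s * s = 1 ∧ ‖b - (‖b‖ / 2) • s‖ ≤ ‖b‖ / 2 := by
  have h0 : ∀ x ∈ spectrum ℝ b, x ≠ 0 := fun x hx h =>
    (spectrum.zero_notMem_iff ℝ).2 hu (h ▸ hx)
  have hc : ContinuousOn Real.sign (spectrum ℝ b) := by
    intro x hx
    refine ContinuousAt.continuousWithinAt ?_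
    rcases lt_or_gt_of_ne (h0 x hx) with h | h
    · exact continuousAt_const.congr (f := fun _ => (-1 : ℝ))
        ((eventually_lt_nhds h).mono fun y hy => (Real.sign_of_neg hy).symm)
    · exact continuousAt_const.congr (f := fun _ => (1 : ℝ))
        ((eventually_gt_nhds h).mono fun y hy => (Real.sign_of_pos hy).symm)
  refine ⟨cfc Real.sign b, cfc_predicate _ _, ?_, ?_⟩
  · rw [← cfc_mul Real.sign Real.sign b, ← cfc_one ℝ b]
    refine cfc_congr fun x hx => ?_
    rcases lt_or_gt_of_ne (h0 x hx) with h | h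
    · simp [Real.sign_of_neg h]
    · simp [Real.sign_of_pos h]
  · have h : b - (‖b‖ / 2) • cfc Real.sign b = cfc (fun x => x - (‖b‖ / 2) • Real.sign x) b := by
      rw [cfc_sub (fun x : ℝ => x) (fun x => (‖b‖ / 2) • Real.sign x) b, cfc_id' ℝ b,
        cfc_smul (‖b‖ / 2) Real.sign b]
    rw [h]
    refine norm_cfc_le (by positivity) fun x hx => ?_
    have hx' : |x| ≤ ‖b‖ := by
      rcases subsingleton_or_nontrivial A with hA | hA
      · exact absurd hx (by simp [spectrum.of_subsingleton])
      · exact spectrum.norm_le_norm_of_mem hx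
    rw [abs_le] at hx'
    rw [Real.norm_eq_abs, abs_le]
    rcases lt_or_gt_of_ne (h0 x hx) with h | h
    · rw [Real.sign_of_neg h, smul_eq_mul]
      constructor <;> linarith
    · rw [Real.sign_of_pos h, smul_eq_mul]
      constructor <;> linarith

/-- On a C⋆-algebra of real rank zero, a bounded functional vanishing on projections is zero. -/
lemma RealRankZero.eq_zero_of_forall_isProjection (hrr : RealRankZero A) (φ : A →ₗ[ℂ] ℂ)
    (hφ : Continuous φ) (hproj : ∀ p, IsProjection p → φ p = 0) : φ = 0 := by
  have hsymm : ∀ s : A, IsSelfAdjoint s → s * s = 1 → φ s = 0 := by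
    intro s hs hss
    have h1 : φ 1 = 0 := hproj 1 ⟨one_mul 1, star_one A⟩
    have hp : φ ((1 / 2 : ℂ) • (1 + s)) = 0 := by
      refine hproj _ ⟨?_, ?_⟩
      · rw [smul_mul_smul_comm, add_mul, mul_add, mul_add, hss, one_mul, one_mul, mul_one]
        module
      · rw [star_smul, star_add, star_one, hs.star_eq]
        simp
    simpa [h1] using hp
  have hhalf : ∀ C : ℝ, 0 ≤ C → (∀ a : selfAdjoint A, ‖φ a‖ ≤ C * ‖a‖) →
      ∀ a : selfAdjoint A, ‖φ a‖ ≤ C / 2 * ‖a‖ := by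
    intro C hC h a
    refine hrr.induction (P := fun a : selfAdjoint A => ‖φ a‖ ≤ C / 2 * ‖a‖) ?_ ?_ a
    · intro b hb
      obtain ⟨s, hs, hss, hle⟩ := b.2.exists_symmetry_norm_sub_le hb
      have hsub : IsSelfAdjoint ((b : A) - (‖(b : A)‖ / 2) • s) :=
        b.2.sub ((IsSelfAdjoint.all _).smul hs)
      have hb' := h ⟨_, hsub⟩
      have hs' : φ ((‖(b : A)‖ / 2) • s) = 0 := by
        rw [← Complex.coe_smul, map_smul, hsymm s hs hss, smul_zero]
      calc ‖φ b‖ = ‖φ ((b : A) - (‖(b : A)‖ / 2) • s)‖ := by rw [map_sub, hs', sub_zero]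
        _ ≤ C * ‖(b : A) - (‖(b : A)‖ / 2) • s‖ := hb'
        _ ≤ C * (‖(b : A)‖ / 2) := by gcongr
        _ = C / 2 * ‖b‖ := by rw [AddSubgroup.coe_norm]; ring
    · exact isClosed_le (hφ.comp continuous_subtype_val).norm (by fun_prop)
  let Φ : A →L[ℂ] ℂ := ⟨φ, hφ⟩
  have hpow : ∀ (n : ℕ) (a : selfAdjoint A), ‖φ a‖ ≤ ‖Φ‖ / 2 ^ n * ‖a‖ := by
    intro n
    induction n with
    | zero =>
      intro a
      rw [pow_zero, div_one]
      exact Φ.le_opNorm (a : A)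
    | succ n ih =>
      have h := hhalf _ (by positivity) ih
      rwa [div_div, ← pow_succ] at h
  have hsa : ∀ a : A, IsSelfAdjoint a → φ a = 0 := by
    intro a ha
    have hlim : Filter.Tendsto (fun n : ℕ => ‖Φ‖ / 2 ^ n * ‖(⟨a, ha⟩ : selfAdjoint A)‖)
        Filter.atTop (nhds (0 * ‖(⟨a, ha⟩ : selfAdjoint A)‖)) :=
      (tendsto_const_nhds.div_atTop
        (tendsto_pow_atTop_atTop_of_one_lt one_lt_two)).mul_const _
    rw [zero_mul] at hlim
    exact norm_le_zero_iff.1 (ge_of_tendsto' hlim fun n => hpow n ⟨a, ha⟩)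
  ext a
  rw [← realPart_add_I_smul_imaginaryPart a, map_add, map_smul, hsa _ (realPart a).2,
    hsa _ (imaginaryPart a).2]
  simp

end RealRankZero

/-- Let `A` be a unital C*-algebra with real rank zero and `τ` a tracial
state on `A` such that whenever `p`, `q` are projections in matrix algebras over `A` with
`(Tr ⊗ τ) p < (Tr ⊗ τ) q`, then `p` is Cuntz subequivalent to `q`.  Then `τ` is the unique
tracial state on `A`. -/
theorem tracialState_unique_of_comparison {A : Type*} [CStarAlgebra A] [PartialOrder A]
    [StarOrderedRing A] (hrr : RealRankZero A) (τ : A →ₗ[ℂ] ℂ) (hτ : IsTracialState τ)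
    (hcomp : ∀ (m n : ℕ) (p : Matrix (Fin m) (Fin m) A) (q : Matrix (Fin n) (Fin n) A),
      IsProjection p → IsProjection q → matTrace τ p < matTrace τ q → CuntzLE p q) :
    ∀ σ : A →ₗ[ℂ] ℂ, IsTracialState σ → σ = τ := by
  intro σ hσ
  refine sub_eq_zero.1 (hrr.eq_zero_of_forall_isProjection (σ - τ)
    (hσ.continuous.sub hτ.continuous) fun p hp => ?_)
  rw [LinearMap.sub_apply, hτ.apply_eq_of_comparison hcomp hσ hp, sub_self]
end
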